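/- arXiv:1403.1522 — 6 statements merged into one kernel-verified Lean document; each statement's English description precedes it below -/
import Mathlib

section
/- Suppose g : (0,∞) → ℝ is a continuous bounded function with g(x) > 0 for all x > 0, and suppose that u vanishes on the graph of g, i.e. u(x, g(x)) = 0 for every x > 0. Then u(x,0) = f(x) = 0 for all x ∈ ℝ. -/
open MeasureTheory Real

/-- The integral of `f` against the kernel `(z - y) ^ n * exp (-s * (z - y) ^ 2)`. -/
noncomputable def gaussMoment (f : ℝ → ℝ) (n : ℕ) (s : ℝ) (z : ℂ) : ℂ :=
  ∫ y : ℝ, (z - y) ^ n * Complex.exp (-(s : ℂ) * (z - y) ^ 2) * (f y : ℂ)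

theorem norm_cexp_neg_mul_sub_sq (s : ℝ) (z : ℂ) (y : ℝ) :
    ‖Complex.exp (-(s : ℂ) * (z - y) ^ 2)‖ = Real.exp (s * z.im ^ 2 - s * (z.re - y) ^ 2) := by
  rw [Complex.norm_exp]
  congr 1
  simp [pow_two]
  ring

theorem exists_integrable_bound_gaussMoment {f : ℝ → ℝ} {M : ℝ} (hf : ∀ x, |f x| ≤ M)
    (n : ℕ) (R : ℝ) {σ : ℝ} (hσ : 0 < σ) (S : ℝ) :
    ∃ bound : ℝ → ℝ, Integrable bound ∧ ∀ (z : ℂ) (s y : ℝ), ‖z‖ ≤ R → σ ≤ s → s ≤ S →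
      ‖(z - y) ^ n * Complex.exp (-(s : ℂ) * (z - y) ^ 2) * (f y : ℂ)‖ ≤ bound y := by
  refine ⟨fun y => n.factorial * Real.exp (R + S * R ^ 2 + (1 + 2 * S * R) ^ 2 / (2 * σ)) *
    Real.exp (-(σ / 2) * y ^ 2) * M,
    ((integrable_exp_neg_mul_sq (by positivity)).const_mul _).mul_const _, ?_⟩
  intro z s y hz h1 h2
  have hM : 0 ≤ M := (abs_nonneg _).trans (hf 0)
  have hR : 0 ≤ R := (norm_nonneg _).trans hz
  have hs : 0 < s := hσ.trans_le h1
  have hS : 0 < S := hs.trans_le h2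
  rw [norm_mul, norm_mul, norm_pow, norm_cexp_neg_mul_sub_sq, Complex.norm_real, Real.norm_eq_abs]
  have hw : ‖z - y‖ ≤ R + |y| := by
    refine (norm_sub_le _ _).trans ?_
    rw [Complex.norm_real, Real.norm_eq_abs]
    gcongr
  have hpow : ‖z - y‖ ^ n ≤ n.factorial * Real.exp (R + |y|) := by
    have h := Real.pow_div_factorial_le_exp (R + |y|) (by positivity) n
    rw [div_le_iff₀ (by positivity)] at h
    calc ‖z - y‖ ^ n ≤ (R + |y|) ^ n := by gcongr
      _ ≤ _ := by linarith
  have him : z.im ^ 2 ≤ R ^ 2 := by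
    rw [← sq_abs]; gcongr; exact (Complex.abs_im_le_norm z).trans hz
  have hre : |z.re| ≤ R := (Complex.abs_re_le_norm z).trans hz
  have hexp : s * z.im ^ 2 - s * (z.re - y) ^ 2 ≤ S * R ^ 2 + 2 * S * R * |y| - σ * y ^ 2 := by
    have e1 : s * z.im ^ 2 ≤ S * R ^ 2 := by gcongr
    have e2 : z.re * y ≤ R * |y| := by
      calc z.re * y ≤ |z.re * y| := le_abs_self _
        _ = |z.re| * |y| := abs_mul _ _
        _ ≤ _ := by gcongr
    have e3 : s * (z.re * y) ≤ S * (R * |y|) := by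
      calc s * (z.re * y) ≤ s * (R * |y|) := by gcongr
        _ ≤ _ := by gcongr
    have e4 : σ * y ^ 2 ≤ s * y ^ 2 := by gcongr
    nlinarith [mul_nonneg hs.le (sq_nonneg z.re)]
  have hyoung : (1 + 2 * S * R) * |y| ≤ (1 + 2 * S * R) ^ 2 / (2 * σ) + σ / 2 * y ^ 2 := by
    rw [← sq_abs y]
    have : (1 + 2 * S * R) ^ 2 / (2 * σ) + σ / 2 * |y| ^ 2 - (1 + 2 * S * R) * |y|
        = ((1 + 2 * S * R) - σ * |y|) ^ 2 / (2 * σ) := by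
      field_simp
      ring
    have h0 : 0 ≤ ((1 + 2 * S * R) - σ * |y|) ^ 2 / (2 * σ) := by positivity
    linarith
  calc ‖z - y‖ ^ n * Real.exp (s * z.im ^ 2 - s * (z.re - y) ^ 2) * |f y|
      ≤ (n.factorial * Real.exp (R + |y|)) *
        Real.exp (S * R ^ 2 + 2 * S * R * |y| - σ * y ^ 2) * M := by
        gcongr
        exact hf y
    _ = n.factorial * Real.exp (R + |y| + (S * R ^ 2 + 2 * S * R * |y| - σ * y ^ 2)) * M := by
        rw [Real.exp_add (R + |y|)]; ring
    _ ≤ n.factorial * Real.exp (R + S * R ^ 2 + (1 + 2 * S * R) ^ 2 / (2 * σ)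
          + -(σ / 2) * y ^ 2) * M := by
        refine mul_le_mul_of_nonneg_right
          (mul_le_mul_of_nonneg_left (Real.exp_le_exp.2 ?_) (by positivity)) hM
        linarith
    _ = _ := by rw [Real.exp_add]; ring

theorem continuous_gaussMoment_integrand {f : ℝ → ℝ} (hf : Continuous f) (n : ℕ) (s : ℝ) (z : ℂ) :
    Continuous fun y : ℝ => (z - y) ^ n * Complex.exp (-(s : ℂ) * (z - y) ^ 2) * (f y : ℂ) := by
  fun_prop

section Moments

variable {f : ℝ → ℝ} {M : ℝ}

theorem integrable_gaussMoment (hc : Continuous f) (hf : ∀ x, |f x| ≤ M) (n : ℕ) {s : ℝ}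
    (hs : 0 < s) (z : ℂ) :
    Integrable fun y : ℝ => (z - y) ^ n * Complex.exp (-(s : ℂ) * (z - y) ^ 2) * (f y : ℂ) := by
  obtain ⟨b, hb, h⟩ := exists_integrable_bound_gaussMoment hf n ‖z‖ hs s
  exact hb.mono' (continuous_gaussMoment_integrand hc n s z).aestronglyMeasurable
    (.of_forall fun y => h z s y le_rfl le_rfl le_rfl)

theorem continuousAt_gaussMoment (hc : Continuous f) (hf : ∀ x, |f x| ≤ M) (n : ℕ) {s : ℝ}
    (hs : 0 < s) (z : ℂ) :
    ContinuousAt (fun p : ℂ × ℝ => gaussMoment f n p.2 p.1) (z, s) := by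
  obtain ⟨b, hb, h⟩ := exists_integrable_bound_gaussMoment hf n (‖z‖ + 1) (half_pos hs) (2 * s)
  refine continuousAt_of_dominated (bound := b) (.of_forall fun p =>
    (continuous_gaussMoment_integrand hc n p.2 p.1).aestronglyMeasurable) ?_ hb
    (.of_forall fun y => by fun_prop)
  have h1 : ∀ᶠ p : ℂ × ℝ in nhds (z, s), ‖p.1‖ < ‖z‖ + 1 :=
    (continuous_fst.norm.tendsto (z, s)).eventually (gt_mem_nhds (by simp))
  have h2 : ∀ᶠ p : ℂ × ℝ in nhds (z, s), s / 2 < p.2 :=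
    (continuous_snd.tendsto (z, s)).eventually (lt_mem_nhds (by simpa using hs))
  have h3 : ∀ᶠ p : ℂ × ℝ in nhds (z, s), p.2 < 2 * s :=
    (continuous_snd.tendsto (z, s)).eventually (gt_mem_nhds (by simp; linarith))
  filter_upwards [h1, h2, h3] with p hp1 hp2 hp3
  exact .of_forall fun y => h p.1 p.2 y hp1.le hp2.le hp3.le

theorem hasDerivAt_gaussMoment_time (hc : Continuous f) (hf : ∀ x, |f x| ≤ M) (n : ℕ) {s : ℝ}
    (hs : 0 < s) (z : ℂ) :
    HasDerivAt (fun s => gaussMoment f n s z) (-gaussMoment f (n + 2) s z) s := by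
  obtain ⟨b, hb, h⟩ := exists_integrable_bound_gaussMoment hf (n + 2) ‖z‖ (half_pos hs) (2 * s)
  have key := hasDerivAt_integral_of_dominated_loc_of_deriv_le (μ := volume) (𝕜 := ℝ)
    (F := fun (s : ℝ) (y : ℝ) => (z - y) ^ n * Complex.exp (-(s : ℂ) * (z - y) ^ 2) * (f y : ℂ))
    (F' := fun (s : ℝ) (y : ℝ) =>
      -((z - y) ^ (n + 2) * Complex.exp (-(s : ℂ) * (z - y) ^ 2) * (f y : ℂ)))
    (x₀ := s) (s := Set.Icc (s / 2) (2 * s)) (bound := b)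
    (Icc_mem_nhds (by linarith) (by linarith))
    (.of_forall fun s => (continuous_gaussMoment_integrand hc n s z).aestronglyMeasurable)
    (integrable_gaussMoment hc hf n hs z)
    (continuous_gaussMoment_integrand hc (n + 2) s z).neg.aestronglyMeasurable
    (.of_forall fun y r hr => by
      rw [norm_neg]
      exact h z r y le_rfl hr.1 hr.2) hb
    (.of_forall fun y r _ => by
      have h1 : HasDerivAt (fun r : ℝ => -(r : ℂ) * (z - y) ^ 2) (-1 * (z - y) ^ 2) r :=
        ((Complex.ofRealCLM.hasDerivAt (x := r)).neg).mul_const _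
      convert! (h1.cexp.const_mul ((z - y) ^ n)).mul_const (f y : ℂ) using 1
      ring)
  have := key.2
  rw [integral_neg] at this
  exact this

theorem hasDerivAt_gaussMoment_zero (hc : Continuous f) (hf : ∀ x, |f x| ≤ M) {s : ℝ}
    (hs : 0 < s) (z : ℂ) :
    HasDerivAt (gaussMoment f 0 s) (-(2 * s) * gaussMoment f 1 s z) z := by
  obtain ⟨b, hb, h⟩ := exists_integrable_bound_gaussMoment hf 1 (‖z‖ + 1) hs s
  have key := hasDerivAt_integral_of_dominated_loc_of_deriv_le (μ := volume) (𝕜 := ℂ)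
    (F := fun (z : ℂ) (y : ℝ) => (z - y) ^ 0 * Complex.exp (-(s : ℂ) * (z - y) ^ 2) * (f y : ℂ))
    (F' := fun (z : ℂ) (y : ℝ) => (-(2 * s) : ℂ) *
      ((z - y) ^ 1 * Complex.exp (-(s : ℂ) * (z - y) ^ 2) * (f y : ℂ)))
    (x₀ := z) (s := Metric.closedBall z 1) (bound := fun y => ‖(-(2 * s) : ℂ)‖ * b y)
    (Metric.closedBall_mem_nhds z one_pos)
    (.of_forall fun z => (continuous_gaussMoment_integrand hc 0 s z).aestronglyMeasurable)
    (integrable_gaussMoment hc hf 0 hs z)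
    ((continuous_gaussMoment_integrand hc 1 s z).const_mul _).aestronglyMeasurable
    (.of_forall fun y w hw => by
      rw [norm_mul]
      have hw' : ‖w‖ ≤ ‖z‖ + 1 := norm_le_norm_add_const_of_dist_le hw
      gcongr
      exact h w s y hw' le_rfl le_rfl) (hb.const_mul _)
    (.of_forall fun y w _ => by
      have h1 : HasDerivAt (fun w : ℂ => -(s : ℂ) * (w - y) ^ 2)
          (-(s : ℂ) * ((2 : ℕ) * (w - y) ^ (2 - 1) * 1)) w :=
        (((hasDerivAt_id w).sub_const _).pow 2).const_mul _
      convert! (h1.cexp.const_mul 1).mul_const (f y : ℂ) using 1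
      push_cast
      ring)
  have := key.2
  rw [integral_const_mul] at this
  exact this

theorem hasDerivAt_gaussMoment_one (hc : Continuous f) (hf : ∀ x, |f x| ≤ M) {s : ℝ}
    (hs : 0 < s) (z : ℂ) :
    HasDerivAt (gaussMoment f 1 s) (gaussMoment f 0 s z - 2 * s * gaussMoment f 2 s z) z := by
  obtain ⟨b, hb, h⟩ := exists_integrable_bound_gaussMoment hf 0 (‖z‖ + 1) hs s
  obtain ⟨b', hb', h'⟩ := exists_integrable_bound_gaussMoment hf 2 (‖z‖ + 1) hs s
  have key := hasDerivAt_integral_of_dominated_loc_of_deriv_le (μ := volume) (𝕜 := ℂ)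
    (F := fun (z : ℂ) (y : ℝ) => (z - y) ^ 1 * Complex.exp (-(s : ℂ) * (z - y) ^ 2) * (f y : ℂ))
    (F' := fun (z : ℂ) (y : ℝ) =>
      (z - y) ^ 0 * Complex.exp (-(s : ℂ) * (z - y) ^ 2) * (f y : ℂ) - (2 * s : ℂ) *
      ((z - y) ^ 2 * Complex.exp (-(s : ℂ) * (z - y) ^ 2) * (f y : ℂ)))
    (x₀ := z) (s := Metric.closedBall z 1) (bound := fun y => b y + ‖(2 * s : ℂ)‖ * b' y)
    (Metric.closedBall_mem_nhds z one_pos)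
    (.of_forall fun z => (continuous_gaussMoment_integrand hc 1 s z).aestronglyMeasurable)
    (integrable_gaussMoment hc hf 1 hs z)
    ((continuous_gaussMoment_integrand hc 0 s z).sub
      ((continuous_gaussMoment_integrand hc 2 s z).const_mul _)).aestronglyMeasurable
    (.of_forall fun y w hw => by
      have hw' : ‖w‖ ≤ ‖z‖ + 1 := norm_le_norm_add_const_of_dist_le hw
      refine (norm_sub_le _ _).trans (add_le_add (h w s y hw' le_rfl le_rfl) ?_)
      rw [norm_mul]
      gcongr
      exact h' w s y hw' le_rfl le_rfl) (hb.add (hb'.const_mul _))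
    (.of_forall fun y w _ => by
      have h1 : HasDerivAt (fun w : ℂ => -(s : ℂ) * (w - y) ^ 2)
          (-(s : ℂ) * ((2 : ℕ) * (w - y) ^ (2 - 1) * 1)) w :=
        (((hasDerivAt_id w).sub_const _).pow 2).const_mul _
      have h2 : HasDerivAt (fun w : ℂ => (w - y) ^ 1) ((1 : ℕ) * (w - y) ^ (1 - 1) * 1) w :=
        ((hasDerivAt_id w).sub_const _).pow 1
      convert! (h2.mul h1.cexp).mul_const (f y : ℂ) using 1
      push_cast
      ring)
  have := key.2
  rw [integral_sub (integrable_gaussMoment hc hf 0 hs z)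
    ((integrable_gaussMoment hc hf 2 hs z).const_mul _), integral_const_mul] at this
  exact this

theorem norm_gaussMoment_zero_le (hf : ∀ x, |f x| ≤ M) {s : ℝ} (hs : 0 < s) (z : ℂ) :
    ‖gaussMoment f 0 s z‖ ≤ M * √(π / s) * Real.exp (s * z.im ^ 2) := by
  have hint : Integrable fun y : ℝ => Real.exp (s * z.im ^ 2) * Real.exp (-s * (z.re - y) ^ 2) * M :=
    ((((integrable_exp_neg_mul_sq hs).comp_sub_left z.re)).const_mul _).mul_const _
  refine (norm_integral_le_of_norm_le hint (.of_forall fun y => ?_)).trans_eq ?_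
  · rw [pow_zero, one_mul, norm_mul, norm_cexp_neg_mul_sub_sq, Complex.norm_real, Real.norm_eq_abs,
      sub_eq_add_neg, Real.exp_add, neg_mul]
    gcongr
    exact hf y
  · rw [integral_mul_const, integral_const_mul,
      integral_sub_left_eq_self (fun y => Real.exp (-s * y ^ 2)) volume z.re, integral_gaussian]
    ring

end Moments

/-- `v` is a classical solution of the heat equation `vₜ = vₓₓ` for times `t > τ`. -/
structure IsCaloric (τ : ℝ) (v : ℝ → ℝ → ℝ) : Prop where
  continuousOn : ContinuousOn (fun p : ℝ × ℝ => v p.1 p.2) {p | τ < p.2}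
  exists_deriv : ∃ vx vxx : ℝ → ℝ → ℝ, ∀ x t, τ < t →
    HasDerivAt (fun x => v x t) (vx x t) x ∧ HasDerivAt (fun x => vx x t) (vxx x t) x ∧
      HasDerivAt (v x) (vxx x t) t

namespace IsCaloric

variable {τ : ℝ} {v w : ℝ → ℝ → ℝ}

theorem mono (hv : IsCaloric τ v) {τ' : ℝ} (h : τ ≤ τ') : IsCaloric τ' v := by
  obtain ⟨vx, vxx, hd⟩ := hv.exists_deriv
  exact ⟨hv.continuousOn.mono fun p hp => h.trans_lt hp,
    vx, vxx, fun x t ht => hd x t (h.trans_lt ht)⟩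

theorem const_mul (hv : IsCaloric τ v) (c : ℝ) : IsCaloric τ fun x t => c * v x t := by
  obtain ⟨vx, vxx, hd⟩ := hv.exists_deriv
  refine ⟨hv.continuousOn.const_smul c,
    fun x t => c * vx x t, fun x t => c * vxx x t, fun x t ht => ?_⟩
  obtain ⟨h1, h2, h3⟩ := hd x t ht
  exact ⟨h1.const_mul c, h2.const_mul c, h3.const_mul c⟩

theorem sub (hv : IsCaloric τ v) (hw : IsCaloric τ w) : IsCaloric τ fun x t => v x t - w x t := by
  obtain ⟨vx, vxx, hd⟩ := hv.exists_deriv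
  obtain ⟨wx, wxx, hd'⟩ := hw.exists_deriv
  refine ⟨hv.continuousOn.sub hw.continuousOn,
    fun x t => vx x t - wx x t, fun x t => vxx x t - wxx x t, fun x t ht => ?_⟩
  obtain ⟨h1, h2, h3⟩ := hd x t ht
  obtain ⟨h1', h2', h3'⟩ := hd' x t ht
  exact ⟨h1.sub h1', h2.sub h2', h3.sub h3'⟩

end IsCaloric

theorem IsLocalMax.second_deriv_nonpos {φ φ' : ℝ → ℝ} {φ'' x : ℝ} (h : IsLocalMax φ x)
    (h1 : ∀ x, HasDerivAt φ (φ' x) x) (h2 : HasDerivAt φ' φ'' x) : φ'' ≤ 0 := by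
  by_contra! hpos
  have hd : deriv φ = φ' := funext fun x => (h1 x).deriv
  have hmin : IsLocalMin φ x := isLocalMin_of_deriv_deriv_pos (by rwa [hd, h2.deriv])
    h.deriv_eq_zero (h1 x).continuousAt
  have hconst : φ =ᶠ[nhds x] fun _ => φ x := by
    filter_upwards [h, hmin] with y hy hy' using le_antisymm hy hy'
  have hzero : φ' =ᶠ[nhds x] fun _ => 0 := by
    filter_upwards [hconst.eventuallyEq_nhds] with y hy
    rw [← (h1 y).deriv, hy.deriv_eq, deriv_const]
  have := hzero.deriv_eq
  rw [h2.deriv, deriv_const] at this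
  exact hpos.ne' this

theorem HasDerivAt.nonneg_of_le_left {φ : ℝ → ℝ} {φ' t r : ℝ} (h : HasDerivAt φ φ' t)
    (hr : r < t) (hle : ∀ s, r ≤ s → s ≤ t → φ s ≤ φ t) : 0 ≤ φ' := by
  have hmax : IsLocalMaxOn φ (Set.Icc r t) t :=
    Filter.eventually_of_mem self_mem_nhdsWithin fun s hs => hle s hs.1 hs.2
  have hcone : r - t ∈ posTangentConeAt (Set.Icc r t) t :=
    sub_mem_posTangentConeAt_of_segment_subset (by
      rw [segment_symm, segment_eq_Icc hr.le])
  have := hmax.hasFDerivWithinAt_nonpos h.hasFDerivAt.hasFDerivWithinAt hcone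
  simp only [ContinuousLinearMap.toSpanSingleton_apply, smul_eq_mul] at this
  nlinarith

/-- Maximum principle for the heat equation in the region `{x ≥ 1, γ x ≤ t ≤ T}`. -/
theorem IsCaloric.nonpos_of_nonpos_on_graph {τ T M : ℝ} {v : ℝ → ℝ → ℝ} {γ : ℝ → ℝ}
    (hv : IsCaloric τ v) (hγ : ContinuousOn γ (Set.Ici 1)) (hτ : ∀ x, 1 ≤ x → τ < γ x)
    (hM : ∀ x t, 1 ≤ x → γ x ≤ t → t ≤ T → v x t ≤ M)
    (hside : ∀ t, γ 1 ≤ t → t ≤ T → v 1 t ≤ 0)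
    (hgraph : ∀ x, 1 ≤ x → v x (γ x) ≤ 0)
    {x t : ℝ} (hx : 1 ≤ x) (ht : γ x ≤ t) (htT : t ≤ T) : v x t ≤ 0 := by
  obtain ⟨vx, vxx, hd⟩ := hv.exists_deriv
  refine le_of_forall_pos_le_add fun δ hδ => ?_
  have hN : 0 < x ^ 2 + 3 * (t - τ) := by
    have := hτ x hx
    nlinarith
  obtain ⟨ε, hε, hεδ⟩ : ∃ ε : ℝ, 0 < ε ∧ ε * (x ^ 2 + 3 * (t - τ)) = δ :=
    ⟨δ / (x ^ 2 + 3 * (t - τ)), by positivity, by field_simp⟩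
  obtain ⟨R, hxR, hRM⟩ : ∃ R : ℝ, x ≤ R ∧ M ≤ ε * R ^ 2 := by
    refine ⟨max x (max 1 (M / ε)), le_max_left _ _, ?_⟩
    set R := max x (max 1 (M / ε))
    have h1 : 1 ≤ R := (le_max_left _ _).trans (le_max_right _ _)
    have h2 : M / ε ≤ R := (le_max_right _ _).trans (le_max_right _ _)
    rw [div_le_iff₀ hε] at h2
    nlinarith [mul_nonneg hε.le (mul_nonneg (by linarith : 0 ≤ R) (by linarith : 0 ≤ R - 1))]
  set V : ℝ × ℝ → ℝ := fun p => v p.1 p.2 - ε * (p.1 ^ 2 + 3 * (p.2 - τ)) with hV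
  set K : Set (ℝ × ℝ) := {p | p.1 ∈ Set.Icc 1 R ∧ γ p.1 ≤ p.2 ∧ p.2 ≤ T} with hK
  have hxtK : (x, t) ∈ K := ⟨⟨hx, hxR⟩, ht, htT⟩
  suffices ∀ p ∈ K, V p ≤ 0 by
    have := this _ hxtK
    simp only [hV] at this
    linarith
  have hγR : ContinuousOn γ (Set.Icc 1 R) := hγ.mono Set.Icc_subset_Ici_self
  have hKc : IsCompact K := by
    obtain ⟨m, hm⟩ := (isCompact_Icc.image_of_continuousOn hγR).bddBelow
    refine (isCompact_Icc.prod (isCompact_Icc (a := m) (b := T))).of_isClosed_subset ?_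
      (s := Set.Icc 1 R ×ˢ Set.Icc m T) ?_
    · have hcl : IsClosed (Set.Icc (1 : ℝ) R ×ˢ Set.Iic T) := isClosed_Icc.prod isClosed_Iic
      have := hcl.isClosed_le (f := fun p : ℝ × ℝ => γ p.1) (g := fun p => p.2)
        (hγR.comp continuousOn_fst fun p hp => hp.1) continuousOn_snd
      convert! this using 1
      ext p
      simp only [hK, Set.mem_ofPred_eq, Set.mem_prod, Set.mem_Iic]
      tauto
    · rintro p ⟨hp1, hp2, hp3⟩
      exact ⟨hp1, (hm ⟨p.1, hp1, rfl⟩).trans hp2, hp3⟩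
  have hKτ : ∀ p ∈ K, τ < p.2 := fun p hp => (hτ _ hp.1.1).trans_le hp.2.1
  have hVc : ContinuousOn V K :=
    (hv.continuousOn.mono hKτ).sub (by fun_prop)
  obtain ⟨⟨x₀, t₀⟩, hp, hmax⟩ := hKc.exists_isMaxOn ⟨_, hxtK⟩ hVc
  refine fun p hpK => (hmax hpK).trans ?_
  by_contra! hpos
  obtain ⟨⟨hx1, hxR'⟩, hγt, htT'⟩ := hp
  simp only at hx1 hxR' hγt htT'
  have hτt : τ < t₀ := (hτ _ hx1).trans_le hγt
  simp only [hV] at hpos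
  have hbar : 0 ≤ ε * (x₀ ^ 2 + 3 * (t₀ - τ)) := by
    have : 0 ≤ t₀ - τ := by linarith
    positivity
  have hne1 : 1 < x₀ := by
    refine lt_of_le_of_ne hx1 fun h => ?_
    subst h
    linarith [hside t₀ hγt htT']
  have hneR : x₀ < R := by
    refine lt_of_le_of_ne hxR' fun h => ?_
    have h1 := hM x₀ t₀ hx1 hγt htT'
    have h2 : 0 < ε * (t₀ - τ) := mul_pos hε (by linarith)
    rw [← h] at hRM
    nlinarith
  have hneγ : γ x₀ < t₀ := by
    refine lt_of_le_of_ne hγt fun h => ?_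
    have := hgraph x₀ hx1
    rw [h] at this
    linarith
  obtain ⟨h1, h2, h3⟩ := hd x₀ t₀ hτt
  have hmaxx : IsLocalMax (fun x => V (x, t₀)) x₀ := by
    have e1 : ∀ᶠ y in nhds x₀, y ∈ Set.Icc 1 R := Icc_mem_nhds hne1 hneR
    have e2 : ∀ᶠ y in nhds x₀, γ y < t₀ :=
      (hγ.continuousAt (Ici_mem_nhds hne1)).eventually (gt_mem_nhds hneγ)
    filter_upwards [e1, e2] with y hy hy'
    exact hmax (show (y, t₀) ∈ K from ⟨hy, hy'.le, htT'⟩)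
  have hxxle := hmaxx.second_deriv_nonpos
    (φ' := fun x => vx x t₀ - ε * (2 * x)) (φ'' := vxx x₀ t₀ - ε * 2)
    (fun y => by
      have hq : HasDerivAt (fun y : ℝ => ε * (y ^ 2 + 3 * (t₀ - τ))) (ε * (2 * y)) y := by
        simpa using ((hasDerivAt_pow 2 y).add_const (3 * (t₀ - τ))).const_mul ε
      exact (hd y t₀ hτt).1.sub hq)
    (h2.sub (by simpa using ((hasDerivAt_id x₀).const_mul 2).const_mul ε))
  have htge : 0 ≤ vxx x₀ t₀ - ε * 3 := by
    have hq : HasDerivAt (fun t : ℝ => ε * (x₀ ^ 2 + 3 * (t - τ))) (ε * 3) t₀ := by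
      simpa using ((((hasDerivAt_id t₀).sub_const τ).const_mul 3).const_add (x₀ ^ 2)).const_mul ε
    refine (h3.sub hq).nonneg_of_le_left hneγ fun s hs hs' => ?_
    exact hmax (show (x₀, s) ∈ K from ⟨⟨hx1, hxR'⟩, hs, hs'.trans htT'⟩)
  linarith

/-- Phragmén–Lindelöf principle for functions of order two in a sector `0 ≤ arg z ≤ θ` of opening
less than `π / 2`. -/
theorem norm_le_of_sector {H : ℂ → ℂ} (hH : Differentiable ℂ H) {A C D θ : ℝ}
    (hθ0 : 0 < θ) (hθ : θ < π / 2)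
    (hgrowth : ∀ z, ‖H z‖ ≤ D * Real.exp (A * ‖z‖ ^ 2))
    (hreal : ∀ r : ℝ, 0 < r → ‖H r‖ ≤ C)
    (hray : ∀ r : ℝ, 0 < r → ‖H (r * Complex.exp (θ * Complex.I))‖ ≤ C)
    {w : ℂ} (hw0 : 0 ≤ w.im) (hw : w.im ≤ θ) : ‖H (Complex.exp w)‖ ≤ C := by
  have hsplit : ∀ z : ℂ, Complex.exp z = (Real.exp z.re : ℂ) * Complex.exp (z.im * Complex.I) := by
    intro z
    rw [Complex.ofReal_exp, ← Complex.exp_add, Complex.re_add_im]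
  refine PhragmenLindelof.horizontal_strip (f := fun w => H (Complex.exp w)) (a := 0) (b := θ)
    (hH.comp Complex.differentiable_exp).diffContOnCl ⟨2, ?_, |A|, ?_⟩ ?_ ?_ hw0 hw
  · rw [sub_zero, lt_div_iff₀ hθ0]
    linarith
  · refine Asymptotics.IsBigO.of_bound |D| (.of_forall fun z => (hgrowth _).trans ?_)
    rw [Real.norm_eq_abs, Real.abs_exp, Complex.norm_exp, ← Real.exp_nat_mul]
    have h1 : Real.exp ((2 : ℕ) * z.re) ≤ Real.exp (2 * |z.re|) := by
      push_cast
      gcongr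
      exact le_abs_self _
    calc D * Real.exp (A * Real.exp ((2 : ℕ) * z.re))
        ≤ |D| * Real.exp (|A| * Real.exp ((2 : ℕ) * z.re)) := by
          gcongr
          · exact le_abs_self _
          · exact le_abs_self _
      _ ≤ _ := by gcongr
  · intro z hz
    rw [hsplit z, hz]
    simpa using hreal _ (Real.exp_pos z.re)
  · intro z hz
    rw [hsplit z, hz]
    exact hray _ (Real.exp_pos z.re)

/-- An entire function with Gaussian growth in the imaginary direction which decays along the
positive real axis at a strictly faster Gaussian rate vanishes identically. -/
theorem eq_zero_of_gaussian_decay {F : ℂ → ℂ} (hF : Differentiable ℂ F) {s κ C : ℝ}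
    (hs : 0 < s) (hsκ : s < κ)
    (hgrowth : ∀ z, ‖F z‖ ≤ C * Real.exp (s * z.im ^ 2))
    (hdecay : ∀ x : ℝ, 0 ≤ x → ‖F x‖ ≤ C * Real.exp (-κ * x ^ 2)) : F = 0 := by
  have hC : 0 ≤ C := by
    have := (norm_nonneg _).trans (hgrowth 0)
    simpa using this
  have hdiag : ∀ x : ℝ, 0 < x → F (x * (1 + Complex.I)) = 0 := by
    intro x hx
    have hbound : ∀ l : ℝ, 0 < l → ‖F (x * (1 + Complex.I))‖ ≤ C * Real.exp (-(2 * x ^ 2) * l) := by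
      intro l hl
      set H : ℂ → ℂ := fun z => F z * Complex.exp ((κ - l * Complex.I) * z ^ 2) with hHdef
      have hnorm : ∀ z : ℂ, ‖H z‖
          = ‖F z‖ * Real.exp (κ * (z.re ^ 2 - z.im ^ 2) + 2 * l * (z.re * z.im)) := by
        intro z
        rw [hHdef]
        simp only [norm_mul, Complex.norm_exp]
        congr 2
        simp [pow_two]
        ring
      have hHle : ∀ z : ℂ, ‖H z‖
          ≤ C * Real.exp (κ * z.re ^ 2 - (κ - s) * z.im ^ 2 + 2 * l * (z.re * z.im)) := by
        intro z
        rw [hnorm]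
        calc _ ≤ C * Real.exp (s * z.im ^ 2) *
              Real.exp (κ * (z.re ^ 2 - z.im ^ 2) + 2 * l * (z.re * z.im)) := by
              gcongr
              exact hgrowth z
          _ = _ := by
              rw [mul_assoc, ← Real.exp_add]
              congr 2
              ring
      obtain ⟨k, hk1, hk⟩ : ∃ k : ℝ, 1 ≤ k ∧ κ + 2 * l * k ≤ (κ - s) * k ^ 2 := by
        have hc : 0 < κ - s := by linarith
        refine ⟨1 + (κ + 2 * l) / (κ - s), ?_, ?_⟩
        · have : 0 ≤ (κ + 2 * l) / (κ - s) := by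
            have : 0 < κ := by linarith
            positivity
          linarith
        · set q := (κ + 2 * l) / (κ - s) with hq
          have hq' : (κ - s) * q = κ + 2 * l := by
            rw [hq]; field_simp
          have hq0 : 0 ≤ q := by
            have : 0 < κ := by linarith
            positivity
          have : (κ - s) * (1 + q) ^ 2 = (κ - s) + (κ - s) * q + (κ + 2 * l) * (1 + q) := by
            rw [← hq']; ring
          nlinarith [mul_nonneg (by linarith : 0 ≤ κ) hq0]
      have hθ0 : 0 < arctan k := arctan_pos.2 (by linarith)
      have hcos : 0 < Real.cos (arctan k) := cos_arctan_pos k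
      have hsin : Real.sin (arctan k) = k * Real.cos (arctan k) := by
        rw [← tan_mul_cos hcos.ne', tan_arctan]
      set w : ℂ := (Real.log (x * √2) : ℂ) + (π / 4 : ℝ) * Complex.I with hw
      have hwim : w.im = π / 4 := by simp [hw]
      have hexpw : Complex.exp w = x * (1 + Complex.I) := by
        rw [hw, Complex.exp_add, ← Complex.ofReal_exp, Real.exp_log (by positivity),
          Complex.exp_mul_I, ← Complex.ofReal_cos, ← Complex.ofReal_sin, cos_pi_div_four,
          sin_pi_div_four]
        have h2 : (√2 : ℂ) * √2 = 2 := by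
          rw [← Complex.ofReal_mul, Real.mul_self_sqrt (by norm_num)]; norm_num
        push_cast
        linear_combination (x * (1 + Complex.I) / 2 : ℂ) * h2
      have key : ‖H (Complex.exp w)‖ ≤ C := by
        refine norm_le_of_sector (A := κ + l) (D := C) (θ := arctan k) ?_ hθ0
          (arctan_lt_pi_div_two k) ?_ ?_ ?_ ?_ ?_
        · exact hF.mul (by fun_prop)
        · intro z
          refine (hHle z).trans ?_
          gcongr
          have hz : ‖z‖ ^ 2 = z.re ^ 2 + z.im ^ 2 := by
            rw [← Complex.normSq_eq_norm_sq, Complex.normSq_apply]; ring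
          rw [hz]
          nlinarith [mul_nonneg hl.le (sq_nonneg (z.re - z.im)),
            mul_nonneg (by linarith : 0 ≤ κ - s) (sq_nonneg z.im),
            mul_nonneg (by linarith : 0 ≤ κ) (sq_nonneg z.im)]
        · intro r hr
          rw [hnorm]
          calc _ ≤ C * Real.exp (-κ * r ^ 2) *
                Real.exp (κ * ((r : ℂ).re ^ 2 - (r : ℂ).im ^ 2)
                  + 2 * l * ((r : ℂ).re * (r : ℂ).im)) := by
                gcongr
                exact hdecay r hr.le
            _ = C := by
                rw [mul_assoc, ← Real.exp_add]
                simp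
        · intro r hr
          have hre : (r * Complex.exp (arctan k * Complex.I) : ℂ).re = r * Real.cos (arctan k) := by
            rw [Complex.re_ofReal_mul, Complex.exp_ofReal_mul_I_re]
          have him : (r * Complex.exp (arctan k * Complex.I) : ℂ).im
              = k * (r * Real.cos (arctan k)) := by
            rw [Complex.im_ofReal_mul, Complex.exp_ofReal_mul_I_im, hsin]; ring
          refine (hHle _).trans (mul_le_of_le_one_right hC (Real.exp_le_one_iff.2 ?_))
          rw [hre, him]
          nlinarith [mul_le_mul_of_nonneg_right hk (sq_nonneg (r * Real.cos (arctan k)))]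
        · rw [hwim]; positivity
        · rw [hwim, ← arctan_one]
          exact arctan_strictMono.monotone hk1
      rw [hexpw, hnorm] at key
      have hre : (x * (1 + Complex.I) : ℂ).re = x := by simp
      have him : (x * (1 + Complex.I) : ℂ).im = x := by simp
      rw [hre, him, ← le_div_iff₀ (Real.exp_pos _)] at key
      refine key.trans_eq ?_
      rw [div_eq_mul_inv, ← Real.exp_neg]
      congr 2
      ring
    have hlim : Filter.Tendsto (fun l : ℝ => C * Real.exp (-(2 * x ^ 2) * l)) Filter.atTop
        (nhds (C * 0)) := by
      refine (Real.tendsto_exp_atBot.comp ?_).const_mul C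
      exact Filter.tendsto_id.const_mul_atTop_of_neg (by nlinarith [pow_pos hx 2])
    rw [mul_zero] at hlim
    exact norm_le_zero_iff.1
      (ge_of_tendsto hlim ((Filter.eventually_gt_atTop 0).mono fun l hl => hbound l hl))
  have hana : AnalyticOnNhd ℂ F Set.univ := fun z _ => hF.analyticAt z
  refine funext fun z => hana.eqOn_zero_of_preconnected_of_frequently_eq_zero
    isPreconnected_univ (Set.mem_univ 0) ?_ (Set.mem_univ z)
  have hseq : Filter.Tendsto (fun x : ℝ => (x * (1 + Complex.I) : ℂ)) (nhdsWithin 0 (Set.Ioi 0))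
      (nhdsWithin 0 {0}ᶜ) := by
    refine tendsto_nhdsWithin_iff.2 ⟨?_, ?_⟩
    · have : Continuous fun x : ℝ => (x * (1 + Complex.I) : ℂ) := by fun_prop
      simpa using (this.tendsto 0).mono_left nhdsWithin_le_nhds
    · filter_upwards [self_mem_nhdsWithin] with x hx h
      have := congrArg Complex.re (Set.mem_singleton_iff.1 h)
      simp at this
      exact (ne_of_gt hx) this
  refine hseq.frequently (Filter.Eventually.frequently ?_)
  filter_upwards [self_mem_nhdsWithin] with x hx using hdiag x hx

open FourierTransform in
theorem eq_zero_of_gaussMoment_eq_zero {f : ℝ → ℝ} {M : ℝ} (hc : Continuous f)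
    (hf : ∀ x, |f x| ≤ M) {s : ℝ} (hs : 0 < s) (h0 : gaussMoment f 0 s = 0) : f = 0 := by
  set h : ℝ → ℂ := fun y => Complex.exp (-(s : ℂ) * y ^ 2) * f y with hh
  have hcont : Continuous h := by fun_prop
  have hint : Integrable h := by
    refine (integrable_gaussMoment hc hf 0 hs 0).congr (.of_forall fun y => ?_)
    simp [hh]
  have hF : 𝓕 h = 0 := by
    funext w
    rw [Real.fourier_real_eq_integral_exp_smul, Pi.zero_apply]
    set η : ℝ := -π * w / s with hη
    have hz : gaussMoment f 0 s (η * Complex.I) = 0 := by rw [h0]; rfl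
    have hE : gaussMoment f 0 s (η * Complex.I) = Complex.exp (s * η ^ 2) *
        ∫ v : ℝ, Complex.exp (↑(-2 * π * v * w) * Complex.I) • h v := by
      rw [gaussMoment, ← integral_const_mul]
      congr 1
      funext y
      rw [pow_zero, one_mul, smul_eq_mul, hh]
      simp only
      rw [← mul_assoc, ← mul_assoc, ← Complex.exp_add, ← Complex.exp_add]
      congr 2
      have hsη : (s : ℂ) * η = -π * w := by
        rw [hη]
        push_cast
        have : (s : ℂ) ≠ 0 := by exact_mod_cast hs.ne'
        field_simp
      push_cast
      linear_combination (2 * y * Complex.I) * hsη - s * η ^ 2 * Complex.I_sq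
    rw [hE] at hz
    exact (mul_eq_zero.1 hz).resolve_left (Complex.exp_ne_zero _)
  have hinv := hcont.fourierInv_fourier_eq hint (by rw [hF]; exact integrable_zero _ _ _)
  have hzero : 𝓕⁻ (0 : ℝ → ℂ) = 0 := by
    funext x
    simp [Real.fourierInv_eq']
  rw [hF, hzero] at hinv
  funext y
  have := congrFun hinv y
  simpa [hh, Complex.exp_ne_zero] using this.symm

/-- The Poisson integral `(4πt)^{-1/2} ∫ exp (-(x - y)² / (4t)) f y dy`. -/
noncomputable def poissonHeat (f : ℝ → ℝ) (x t : ℝ) : ℝ :=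
  (√(4 * π * t))⁻¹ * ∫ y : ℝ, Real.exp (-((x - y) ^ 2) / (4 * t)) * f y

theorem ofReal_integral_exp_eq_gaussMoment (f : ℝ → ℝ) (x t : ℝ) :
    ((∫ y : ℝ, Real.exp (-((x - y) ^ 2) / (4 * t)) * f y : ℝ) : ℂ)
      = gaussMoment f 0 (4 * t)⁻¹ x := by
  rw [gaussMoment, ← integral_complex_ofReal]
  congr 1
  funext y
  push_cast
  rw [pow_zero, one_mul]
  congr 2
  ring

theorem poissonHeat_eq (f : ℝ → ℝ) :
    poissonHeat f = fun x t : ℝ => (√(4 * π * t))⁻¹ * (gaussMoment f 0 (4 * t)⁻¹ x).re := by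
  funext x t
  rw [← ofReal_integral_exp_eq_gaussMoment, Complex.ofReal_re, poissonHeat]

theorem norm_gaussMoment_eq_abs_poissonHeat (f : ℝ → ℝ) (x : ℝ) {t : ℝ} (ht : 0 < t) :
    ‖gaussMoment f 0 (4 * t)⁻¹ x‖ = √(4 * π * t) * |poissonHeat f x t| := by
  have : 0 < √(4 * π * t) := by positivity
  rw [← ofReal_integral_exp_eq_gaussMoment, Complex.norm_real, poissonHeat, abs_mul, abs_inv,
    abs_of_pos this, Real.norm_eq_abs]
  field_simp

section Poisson

variable {f : ℝ → ℝ} {M : ℝ}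

theorem abs_poissonHeat_le (hf : ∀ x, |f x| ≤ M) (x : ℝ) {t : ℝ} (ht : 0 < t) :
    |poissonHeat f x t| ≤ M := by
  have h1 := norm_gaussMoment_zero_le hf (s := (4 * t)⁻¹) (by positivity) x
  have h2 : π / (4 * t)⁻¹ = 4 * π * t := by field_simp
  rw [norm_gaussMoment_eq_abs_poissonHeat f x ht, h2, Complex.ofReal_im, zero_pow two_ne_zero,
    mul_zero, Real.exp_zero, mul_one, mul_comm] at h1
  exact le_of_mul_le_mul_right h1 (by positivity)

theorem isCaloric_poissonHeat (hc : Continuous f) (hf : ∀ x, |f x| ≤ M) :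
    IsCaloric 0 (poissonHeat f) := by
  rw [poissonHeat_eq]
  constructor
  · rintro ⟨x, t⟩ (ht : 0 < t)
    refine ContinuousAt.continuousWithinAt ?_
    have h4 : (4 * t) ≠ 0 := by positivity
    have hr : √(4 * π * t) ≠ 0 := by positivity
    have h1 : ContinuousAt (fun p : ℝ × ℝ => ((p.1 : ℂ), (4 * p.2)⁻¹)) (x, t) := by
      refine ContinuousAt.prodMk (by fun_prop) (ContinuousAt.inv₀ (by fun_prop) h4)
    have h2 : ContinuousAt (fun p : ℝ × ℝ => gaussMoment f 0 (4 * p.2)⁻¹ p.1) (x, t) :=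
      ContinuousAt.comp (f := fun p : ℝ × ℝ => ((p.1 : ℂ), (4 * p.2)⁻¹))
        (g := fun p : ℂ × ℝ => gaussMoment f 0 p.2 p.1)
        (continuousAt_gaussMoment hc hf 0 (by positivity) _) h1
    have h3 : ContinuousAt (fun p : ℝ × ℝ => (gaussMoment f 0 (4 * p.2)⁻¹ p.1).re) (x, t) :=
      Complex.continuous_re.continuousAt.comp h2
    have h5 : ContinuousAt (fun p : ℝ × ℝ => (√(4 * π * p.2))⁻¹) (x, t) :=
      ContinuousAt.inv₀ (by fun_prop) hr
    exact h5.mul h3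
  · refine ⟨fun x t => (√(4 * π * t))⁻¹ *
        (-(2 * ((4 * t)⁻¹ : ℝ)) * gaussMoment f 1 (4 * t)⁻¹ x).re,
      fun x t => (√(4 * π * t))⁻¹ * (-(2 * ((4 * t)⁻¹ : ℝ)) * (gaussMoment f 0 (4 * t)⁻¹ x
        - 2 * ((4 * t)⁻¹ : ℝ) * gaussMoment f 2 (4 * t)⁻¹ x)).re, fun x t ht => ?_⟩
    have hs : 0 < (4 * t)⁻¹ := by positivity
    refine ⟨((hasDerivAt_gaussMoment_zero hc hf hs x).real_of_complex).const_mul _,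
      (((hasDerivAt_gaussMoment_one hc hf hs x).const_mul _).real_of_complex).const_mul _, ?_⟩
    have hinv : HasDerivAt (fun t : ℝ => (4 * t)⁻¹) (-(4 * 1) / (4 * t) ^ 2) t :=
      ((hasDerivAt_id t).const_mul 4).inv (by positivity)
    have hJ : HasDerivAt (fun t : ℝ => gaussMoment f 0 (4 * t)⁻¹ x)
        ((-(4 * 1) / (4 * t) ^ 2) • (-gaussMoment f (0 + 2) (4 * t)⁻¹ x)) t :=
      HasDerivAt.scomp (g₁ := fun s => gaussMoment f 0 s x) (h := fun t : ℝ => (4 * t)⁻¹) t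
        (hasDerivAt_gaussMoment_time hc hf 0 hs x) hinv
    have hre : HasDerivAt (fun t : ℝ => (gaussMoment f 0 (4 * t)⁻¹ x).re)
        ((-(4 * 1) / (4 * t) ^ 2) • (-gaussMoment f (0 + 2) (4 * t)⁻¹ x)).re t :=
      Complex.reCLM.hasFDerivAt.comp_hasDerivAt t hJ
    have hrpos : 0 < 4 * π * t := by positivity
    have hroot : HasDerivAt (fun t : ℝ => (√(4 * π * t))⁻¹)
        (-(4 * π * 1 / (2 * √(4 * π * t))) / √(4 * π * t) ^ 2) t :=
      (((hasDerivAt_id t).const_mul (4 * π)).sqrt hrpos.ne').inv (by positivity)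
    convert! hroot.mul hre using 1
    rw [Real.sq_sqrt hrpos.le]
    have hr : √(4 * π * t) ≠ 0 := by positivity
    have e1 : (-(2 * ((4 * t)⁻¹ : ℝ)) * (gaussMoment f 0 (4 * t)⁻¹ x
        - 2 * ((4 * t)⁻¹ : ℝ) * gaussMoment f 2 (4 * t)⁻¹ x) : ℂ).re
        = -(2 * (4 * t)⁻¹) * ((gaussMoment f 0 (4 * t)⁻¹ x).re
          - 2 * (4 * t)⁻¹ * (gaussMoment f 2 (4 * t)⁻¹ x).re) := by
      have : (-(2 * ((4 * t)⁻¹ : ℝ)) * (gaussMoment f 0 (4 * t)⁻¹ x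
        - 2 * ((4 * t)⁻¹ : ℝ) * gaussMoment f 2 (4 * t)⁻¹ x) : ℂ)
        = ((-(2 * (4 * t)⁻¹) : ℝ) : ℂ) * (gaussMoment f 0 (4 * t)⁻¹ x
        - ((2 * (4 * t)⁻¹ : ℝ) : ℂ) * gaussMoment f 2 (4 * t)⁻¹ x) := by push_cast; ring
      rw [this, Complex.re_ofReal_mul, Complex.sub_re, Complex.re_ofReal_mul]
    simp only [e1]
    rw [Complex.smul_re, Complex.neg_re, zero_add, smul_eq_mul]
    generalize (gaussMoment f 0 (4 * t)⁻¹ x).re = a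
    generalize (gaussMoment f 2 (4 * t)⁻¹ x).re = b
    field_simp
    ring

end Poisson

theorem isCaloric_heatKernel (τ : ℝ) :
    IsCaloric τ fun x t => (√(t - τ))⁻¹ * Real.exp (-x ^ 2 / (4 * (t - τ))) := by
  constructor
  · have h1 : ∀ p : ℝ × ℝ, p ∈ {p : ℝ × ℝ | τ < p.2} → √(p.2 - τ) ≠ 0 := fun p hp =>
      (Real.sqrt_pos.2 (sub_pos.2 hp)).ne'
    have h2 : ∀ p : ℝ × ℝ, p ∈ {p : ℝ × ℝ | τ < p.2} → 4 * (p.2 - τ) ≠ 0 := fun p hp =>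
      (mul_pos four_pos (sub_pos.2 hp)).ne'
    exact (ContinuousOn.inv₀ (by fun_prop) h1).mul
      (Real.continuous_exp.comp_continuousOn (ContinuousOn.div (by fun_prop) (by fun_prop) h2))
  · refine ⟨fun x t => (√(t - τ))⁻¹ * (Real.exp (-x ^ 2 / (4 * (t - τ))) * (-x / (2 * (t - τ)))),
      fun x t => (√(t - τ))⁻¹ * (Real.exp (-x ^ 2 / (4 * (t - τ))) *
        (x ^ 2 / (4 * (t - τ) ^ 2) - 1 / (2 * (t - τ)))), fun x t ht => ?_⟩
    have hr : 0 < t - τ := sub_pos.2 ht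
    have hsq : √(t - τ) ≠ 0 := by positivity
    have hq : HasDerivAt (fun x : ℝ => Real.exp (-x ^ 2 / (4 * (t - τ))))
        (Real.exp (-x ^ 2 / (4 * (t - τ))) * (-x / (2 * (t - τ)))) x := by
      have : HasDerivAt (fun x : ℝ => -x ^ 2 / (4 * (t - τ))) (-x / (2 * (t - τ))) x := by
        convert! ((hasDerivAt_pow 2 x).neg).div_const (4 * (t - τ)) using 1
        push_cast
        field_simp
        ring
      exact this.exp
    refine ⟨hq.const_mul _, ?_, ?_⟩
    · have hlin : HasDerivAt (fun x : ℝ => -x / (2 * (t - τ))) (-1 / (2 * (t - τ))) x :=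
        (hasDerivAt_id x).neg.div_const _
      convert! (hq.mul hlin).const_mul _ using 1
      field_simp
      ring
    · have hid : HasDerivAt (fun t : ℝ => t - τ) 1 t := (hasDerivAt_id t).sub_const τ
      have h1 : HasDerivAt (fun t : ℝ => (√(t - τ))⁻¹) (-(1 / (2 * √(t - τ))) / √(t - τ) ^ 2) t :=
        (hid.sqrt hr.ne').inv hsq
      have h2 : HasDerivAt (fun t : ℝ => -x ^ 2 / (4 * (t - τ))) (x ^ 2 / (4 * (t - τ) ^ 2)) t := by
        convert! (hasDerivAt_const t (-x ^ 2)).div (hid.const_mul 4) (by positivity) using 1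
        field_simp
        ring
      convert! h1.mul h2.exp using 1
      rw [Real.sq_sqrt hr.le]
      field_simp
      ring

/-- A caloric function, bounded above, that vanishes on the graph of `g` has Gaussian decay above
the graph, at a rate faster than the one of the heat kernel started at time `0`. -/
theorem IsCaloric.le_gaussian_of_vanish_on_graph {v : ℝ → ℝ → ℝ} {g : ℝ → ℝ} {M T : ℝ}
    (hv : IsCaloric 0 v) (hM : ∀ x t, 0 < t → v x t ≤ M) (hM0 : 0 ≤ M)
    (hg : ContinuousOn g (Set.Ioi 0)) (hg_pos : ∀ x, 0 < x → 0 < g x)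
    (hgT : ∀ x, 0 < x → g x ≤ T) (hvanish : ∀ x, 0 < x → v x (g x) = 0) :
    ∃ C : ℝ, ∀ x, 1 ≤ x → v x T ≤ C * Real.exp (-(4 * (T - g 1 / 4))⁻¹ * x ^ 2) := by
  set δ := g 1 with hδ
  have hδ0 : 0 < δ := hg_pos 1 one_pos
  have hδT : δ ≤ T := hgT 1 one_pos
  have hg1 : ContinuousOn g (Set.Ici 1) := hg.mono (Set.Ici_subset_Ioi.2 one_pos)
  have hlow : ∀ x t, 1 ≤ x → g x ≤ t → t ≤ δ / 2 → v x t ≤ 0 := by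
    intro x t hx h1 h2
    refine hv.nonpos_of_nonpos_on_graph hg1 (fun x hx => hg_pos x (by linarith))
      (fun x t hx h _ => hM x t ((hg_pos x (by linarith)).trans_le h)) (fun t h h' => ?_)
      (fun x hx => (hvanish x (by linarith)).le) hx h1 h2
    linarith
  set m : ℝ := (√T)⁻¹ * Real.exp (-(1 / (3 * δ))) with hm
  have hT : 0 < T := hδ0.trans_le hδT
  have hm0 : 0 < m := by positivity
  have hw := (isCaloric_heatKernel (δ / 4)).const_mul (M / m)
  refine ⟨M / m * (√(T - δ / 4))⁻¹, fun x hx => ?_⟩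
  have hhigh := ((hv.mono (by positivity : (0 : ℝ) ≤ δ / 4)).sub hw).nonpos_of_nonpos_on_graph
    (γ := fun x => max (g x) (δ / 2)) (T := T) (M := M)
    (ContinuousOn.sup hg1 continuousOn_const) (fun x _ => lt_max_of_lt_right (by linarith))
    (fun x t hx h _ => ?_) (fun t h h' => ?_) (fun x hx => ?_)
    hx (max_le (hgT x (by linarith)) (by linarith)) le_rfl
  · have he : -x ^ 2 / (4 * (T - δ / 4)) = -(4 * (T - δ / 4))⁻¹ * x ^ 2 := by ring
    rw [he] at hhigh
    linarith
  · have ht : 0 < t := (hg_pos x (by linarith)).trans_le ((le_max_left _ _).trans h)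
    have h1 := hM x t ht
    have : 0 ≤ M / m * ((√(t - δ / 4))⁻¹ * Real.exp (-x ^ 2 / (4 * (t - δ / 4)))) := by positivity
    linarith
  · have hδt : δ ≤ t := (le_max_left _ _).trans h
    have hmle : m ≤ (√(t - δ / 4))⁻¹ * Real.exp (-1 ^ 2 / (4 * (t - δ / 4))) := by
      have hr : 0 < t - δ / 4 := by linarith
      rw [hm]
      gcongr
      · linarith
      · rw [one_pow, neg_div, neg_le_neg_iff]
        exact one_div_le_one_div_of_le (by linarith) (by linarith)
    have h1 := hM 1 t (by linarith)
    have h2 : M / m * m ≤ M / m * ((√(t - δ / 4))⁻¹ * Real.exp (-1 ^ 2 / (4 * (t - δ / 4)))) := by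
      gcongr
    rw [div_mul_cancel₀ _ hm0.ne'] at h2
    linarith
  · have h0 : v x (max (g x) (δ / 2)) ≤ 0 := by
      rcases le_total (g x) (δ / 2) with h | h
      · rw [max_eq_right h]
        exact hlow x _ hx h le_rfl
      · rw [max_eq_left h]
        exact (hvanish x (by linarith)).le
    have : 0 ≤ M / m * ((√(max (g x) (δ / 2) - δ / 4))⁻¹ *
      Real.exp (-x ^ 2 / (4 * (max (g x) (δ / 2) - δ / 4)))) := by positivity
    linarith

theorem poissonHeat_data_eq_zero {f : ℝ → ℝ} {M : ℝ} (hc : Continuous f) (hf : ∀ x, |f x| ≤ M)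
    {T κ C : ℝ} (hT : 0 < T) (hκ : (4 * T)⁻¹ < κ)
    (hdecay : ∀ x, 1 ≤ x → |poissonHeat f x T| ≤ C * Real.exp (-κ * x ^ 2)) : f = 0 := by
  have hs : 0 < (4 * T)⁻¹ := by positivity
  have hκ0 : 0 < κ := hs.trans hκ
  have hM : 0 ≤ M := (abs_nonneg _).trans (hf 0)
  have hr : 0 < √(4 * π * T) := by positivity
  have hpi : π / (4 * T)⁻¹ = 4 * π * T := by field_simp
  refine eq_zero_of_gaussMoment_eq_zero hc hf hs (eq_zero_of_gaussian_decay
    (κ := κ) (C := √(4 * π * T) * max C (M * Real.exp κ))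
    (fun z => (hasDerivAt_gaussMoment_zero hc hf hs z).differentiableAt) hs hκ (fun z => ?_)
    fun x hx => ?_)
  · refine (norm_gaussMoment_zero_le hf hs z).trans ?_
    rw [hpi, mul_comm M]
    gcongr
    exact (le_mul_of_one_le_right hM (Real.one_le_exp hκ0.le)).trans (le_max_right _ _)
  · rw [norm_gaussMoment_eq_abs_poissonHeat f x hT, mul_assoc (√(4 * π * T))]
    refine mul_le_mul_of_nonneg_left ?_ hr.le
    rcases le_total 1 x with h | h
    · refine (hdecay x h).trans ?_
      gcongr
      exact le_max_left _ _
    · calc |poissonHeat f x T| ≤ M * Real.exp (κ + -κ * x ^ 2) :=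
            (abs_poissonHeat_le hf x hT).trans
              (le_mul_of_one_le_right hM (Real.one_le_exp (by nlinarith [pow_le_one₀ hx h (n := 2)])))
        _ = M * Real.exp κ * Real.exp (-κ * x ^ 2) := by rw [Real.exp_add]; ring
        _ ≤ _ := by
          gcongr
          exact le_max_right _ _

/-- **Theorem 1.** If a bounded solution of the heat equation on the half-plane,
given by the Poisson formula, vanishes on the graph of a positive bounded continuous
function `g` on `(0, ∞)`, then its initial data `f` vanishes identically. -/
theorem heat_unique_continuation_graph
    (f : ℝ → ℝ) (hf_cont : Continuous f) (M : ℝ) (hf_bdd : ∀ x, |f x| ≤ M)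
    (u : ℝ → ℝ → ℝ)
    (hu : ∀ x t, 0 < t →
      u x t = (Real.sqrt (4 * Real.pi * t))⁻¹ *
        ∫ y : ℝ, Real.exp (-((x - y) ^ 2) / (4 * t)) * f y)
    (hu0 : ∀ x, u x 0 = f x)
    (g : ℝ → ℝ) (hg_cont : ContinuousOn g (Set.Ioi 0))
    (hg_pos : ∀ x, 0 < x → 0 < g x)
    (B : ℝ) (hg_bdd : ∀ x, 0 < x → g x ≤ B)
    (hvanish : ∀ x, 0 < x → u x (g x) = 0) :
    ∀ x : ℝ, u x 0 = 0 := by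
  have hu' : ∀ x t, 0 < t → u x t = poissonHeat f x t := hu
  have hcal := isCaloric_poissonHeat hf_cont hf_bdd
  have hM : 0 ≤ M := (abs_nonneg _).trans (hf_bdd 0)
  have hbd : ∀ x t, 0 < t → |poissonHeat f x t| ≤ M := fun x t ht => abs_poissonHeat_le hf_bdd x ht
  have hvan : ∀ x, 0 < x → poissonHeat f x (g x) = 0 := fun x hx => by
    rw [← hu' x _ (hg_pos x hx), hvanish x hx]
  have hδ := hg_pos 1 one_pos
  have hδB := hg_bdd 1 one_pos
  obtain ⟨C₁, h1⟩ := hcal.le_gaussian_of_vanish_on_graph (fun x t ht => (abs_le.1 (hbd x t ht)).2)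
    hM hg_cont hg_pos hg_bdd hvan
  obtain ⟨C₂, h2⟩ := (hcal.const_mul (-1)).le_gaussian_of_vanish_on_graph
    (fun x t ht => by linarith [(abs_le.1 (hbd x t ht)).1])
    hM hg_cont hg_pos hg_bdd (fun x hx => by rw [hvan x hx, mul_zero])
  have hf0 : f = 0 := by
    refine poissonHeat_data_eq_zero hf_cont hf_bdd (T := B) (C := max C₁ C₂) (by linarith)
      (κ := (4 * (B - g 1 / 4))⁻¹) ?_ fun x hx => abs_le.2 ⟨?_, ?_⟩
    · exact inv_strictAnti₀ (by linarith) (by linarith)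
    · have : C₂ * Real.exp (-(4 * (B - g 1 / 4))⁻¹ * x ^ 2)
          ≤ max C₁ C₂ * Real.exp (-(4 * (B - g 1 / 4))⁻¹ * x ^ 2) := by
        gcongr
        exact le_max_right _ _
      linarith [h2 x hx]
    · refine (h1 x hx).trans ?_
      gcongr
      exact le_max_left _ _
  intro x
  rw [hu0, hf0, Pi.zero_apply]
end

section
/- Suppose f is not identically zero, and let γ ⊂ ℝ × (0,∞) be a nodal curve of u, i.e. γ is a connected component of the zero set {(x,t) : t > 0, u(x,t) = 0} which is the image of an injective continuous proper map Γ : ℝ → ℝ × (0,∞). Then γ has an end point on the line {t = 0}: the closure of γ in ℝ² contains a point of the form (x₀, 0). -/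
open MeasureTheory Real Topology

/-- The one-dimensional heat kernel. -/
noncomputable def heatKernel (z t : ℝ) : ℝ := (√(4 * π * t))⁻¹ * exp (-z ^ 2 / (4 * t))

lemma heatKernel_nonneg (z t : ℝ) : 0 ≤ heatKernel z t := by
  unfold heatKernel
  positivity

lemma continuous_heatKernel (t : ℝ) : Continuous fun z => heatKernel z t := by
  unfold heatKernel
  fun_prop

lemma continuousAt_heatKernel {t : ℝ} (ht : 0 < t) (z : ℝ) :
    ContinuousAt (fun p : ℝ × ℝ => heatKernel p.1 p.2) (z, t) := by
  unfold heatKernel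
  have h1 : √(4 * π * t) ≠ 0 := by positivity
  have h2 : 4 * t ≠ 0 := by positivity
  exact ContinuousAt.mul (ContinuousAt.inv₀ (by fun_prop) h1)
    (continuous_exp.continuousAt.comp (ContinuousAt.div (by fun_prop) (by fun_prop) h2))

lemma hasDerivAt_heatKernel_space {t : ℝ} (ht : 0 < t) (z : ℝ) :
    HasDerivAt (fun z => heatKernel z t) (-z / (2 * t) * heatKernel z t) z := by
  unfold heatKernel
  have h := ((((hasDerivAt_id z).pow 2).neg.div_const (4 * t)).exp).const_mul (√(4 * π * t))⁻¹
  refine h.congr_deriv ?_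
  simp
  field_simp
  ring

lemma hasDerivAt_deriv_heatKernel_space {t : ℝ} (ht : 0 < t) (z : ℝ) :
    HasDerivAt (fun z => -z / (2 * t) * heatKernel z t)
      ((z ^ 2 / (4 * t ^ 2) - 1 / (2 * t)) * heatKernel z t) z := by
  have h := ((hasDerivAt_id z).neg.div_const (2 * t)).mul (hasDerivAt_heatKernel_space ht z)
  refine h.congr_deriv ?_
  simp
  field_simp
  ring

lemma hasDerivAt_heatKernel_time {t : ℝ} (ht : 0 < t) (z : ℝ) :
    HasDerivAt (fun t => heatKernel z t)
      ((z ^ 2 / (4 * t ^ 2) - 1 / (2 * t)) * heatKernel z t) t := by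
  unfold heatKernel
  have hpos : 0 < 4 * π * t := by positivity
  have hs : √(4 * π * t) ≠ 0 := by positivity
  have h1 := ((((hasDerivAt_id t).const_mul (4 * π)).sqrt (by simpa using hpos.ne')).inv
    (by simpa using hs))
  have h2 := ((((hasDerivAt_id t).const_mul 4).inv (by simpa using ht.ne')).const_mul (-z ^ 2)).exp
  refine (h1.mul h2).congr_deriv ?_
  have hsq : √(4 * π * t) ^ 2 = 4 * π * t := Real.sq_sqrt hpos.le
  simp only [id, mul_one, hsq, div_eq_mul_inv]
  simp
  field_simp
  ring

/-- Locally uniformly in `(x, t)`, the heat kernel weighted by `1 + (x - y) ^ 2` is dominated by an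
integrable function of `y`. -/
lemma exists_integrable_bound_heatKernel {t₀ : ℝ} (ht₀ : 0 < t₀) (x₀ : ℝ) :
    ∃ B : ℝ → ℝ, Integrable B ∧ ∀ x t y, |x - x₀| ≤ 1 → t₀ / 2 ≤ t → t ≤ 2 * t₀ →
      (1 + (x - y) ^ 2) * heatKernel (x - y) t ≤ B y := by
  refine ⟨fun y => (√(4 * π * (t₀ / 2)))⁻¹ * ((1 + 16 * t₀) * (exp (1 / (16 * t₀)) *
    exp (-(1 / (32 * t₀)) * (y - x₀) ^ 2))), ?_, ?_⟩
  · exact ((((integrable_exp_neg_mul_sq (by positivity : 0 < 1 / (32 * t₀))).comp_sub_right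
      x₀).const_mul _).const_mul _).const_mul _
  · intro x t y hx ht1 ht2
    have ht : 0 < t := by linarith
    unfold heatKernel
    rw [mul_left_comm]
    beta_reduce
    gcongr ?_ * ?_
    · gcongr
    · set s := (x - y) ^ 2 / (16 * t₀) with hs
      have hs0 : 0 ≤ s := by positivity
      have e1 : -(x - y) ^ 2 / (4 * t) ≤ -2 * s := by
        have : (x - y) ^ 2 / (8 * t₀) ≤ (x - y) ^ 2 / (4 * t) := by
          gcongr _ / ?_
          linarith
        have h2 : 2 * s = (x - y) ^ 2 / (8 * t₀) := by
          rw [hs]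
          field_simp
          ring
        rw [neg_div]
        linarith
      have e2 : 1 + (x - y) ^ 2 ≤ (1 + 16 * t₀) * exp s := by
        have h1 : (x - y) ^ 2 = 16 * t₀ * s := by
          rw [hs]
          field_simp
        have h2 := add_one_le_exp s
        rw [h1]
        nlinarith [mul_pos ht₀ ht₀]
      have e3 : -s ≤ 1 / (16 * t₀) + -(1 / (32 * t₀)) * (y - x₀) ^ 2 := by
        have h1 : (y - x₀) ^ 2 ≤ 2 * (x - y) ^ 2 + 2 := by
          have := (sq_le_one_iff_abs_le_one _).2 hx
          nlinarith [sq_nonneg (x - y + (x - x₀)), sq_nonneg (x - y - (x - x₀))]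
        have h2 : 1 / (16 * t₀) + -(1 / (32 * t₀)) * (y - x₀) ^ 2 + s
            = (2 * (x - y) ^ 2 + 2 - (y - x₀) ^ 2) / (32 * t₀) := by
          rw [hs]
          field_simp
          ring
        have h3 : 0 ≤ (2 * (x - y) ^ 2 + 2 - (y - x₀) ^ 2) / (32 * t₀) := by
          apply div_nonneg <;> linarith
        linarith
      calc (1 + (x - y) ^ 2) * exp (-(x - y) ^ 2 / (4 * t))
          ≤ ((1 + 16 * t₀) * exp s) * exp (-2 * s) := by gcongr
        _ = (1 + 16 * t₀) * exp (-s) := by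
          rw [mul_assoc, ← exp_add]
          ring_nf
        _ ≤ (1 + 16 * t₀) * exp (1 / (16 * t₀) + -(1 / (32 * t₀)) * (y - x₀) ^ 2) := by gcongr
        _ = _ := by rw [exp_add]

/-- Differentiation under the integral sign for kernels dominated by the heat kernel, along a path
`s ↦ (X s, T s)` in the half-plane. -/
lemma hasDerivAt_integral_of_le_heatKernel {f : ℝ → ℝ} (hf : Continuous f) {M : ℝ}
    (hM : ∀ x, |f x| ≤ M) {t₀ : ℝ} (ht₀ : 0 < t₀) (x₀ : ℝ) {X T : ℝ → ℝ} {s₀ C : ℝ} {U : Set ℝ}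
    (hU : U ∈ 𝓝 s₀) (hX : ∀ s ∈ U, |X s - x₀| ≤ 1) (hT1 : ∀ s ∈ U, t₀ / 2 ≤ T s)
    (hT2 : ∀ s ∈ U, T s ≤ 2 * t₀) {F F' : ℝ → ℝ → ℝ} (hF : ∀ s, Continuous (F s))
    (hF' : ∀ s, Continuous (F' s))
    (hFC : ∀ s ∈ U, ∀ y, |F s y| ≤ C * ((1 + (X s - y) ^ 2) * heatKernel (X s - y) (T s)))
    (hF'C : ∀ s ∈ U, ∀ y, |F' s y| ≤ C * ((1 + (X s - y) ^ 2) * heatKernel (X s - y) (T s)))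
    (hd : ∀ s ∈ U, ∀ y, HasDerivAt (fun s => F s y) (F' s y) s) :
    HasDerivAt (fun s => ∫ y, F s y * f y) (∫ y, F' s₀ y * f y) s₀ := by
  obtain ⟨B, hB, hle⟩ := exists_integrable_bound_heatKernel ht₀ x₀
  have hC0 : 0 ≤ C := by
    by_contra! hC
    have h1 := hFC s₀ (mem_of_mem_nhds hU) (X s₀)
    have h2 := (abs_nonneg _).trans h1
    have ht : 0 < T s₀ := by linarith [hT1 s₀ (mem_of_mem_nhds hU)]
    have h3 : 0 < heatKernel (X s₀ - X s₀) (T s₀) := by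
      unfold heatKernel
      positivity
    have h4 : 0 < (1 + (X s₀ - X s₀) ^ 2) * heatKernel (X s₀ - X s₀) (T s₀) := by positivity
    nlinarith
  have hbound : ∀ {G : ℝ → ℝ → ℝ}, (∀ s ∈ U, ∀ y, |G s y| ≤
      C * ((1 + (X s - y) ^ 2) * heatKernel (X s - y) (T s))) →
      ∀ s ∈ U, ∀ y, ‖G s y * f y‖ ≤ C * B y * M := by
    intro G hG s hs y
    rw [norm_mul]
    have h1 := hle (X s) (T s) y (hX s hs) (hT1 s hs) (hT2 s hs)
    have h2 : |G s y| ≤ C * B y := (hG s hs y).trans (by gcongr)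
    exact mul_le_mul h2 (hM y) (abs_nonneg _) ((abs_nonneg _).trans h2)
  have hBint : Integrable fun y => C * B y * M := (hB.const_mul C).mul_const M
  have hmeas : ∀ {G : ℝ → ℝ → ℝ}, (∀ s, Continuous (G s)) → ∀ s,
      AEStronglyMeasurable (fun y => G s y * f y) volume :=
    fun hG s => ((hG s).mul hf).aestronglyMeasurable
  refine (hasDerivAt_integral_of_dominated_loc_of_deriv_le (F := fun s y => F s y * f y)
    (F' := fun s y => F' s y * f y) (bound := fun y => C * B y * M) hU
    (Filter.Eventually.of_forall (hmeas hF)) ?_ (hmeas hF' s₀) ?_ hBint ?_).2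
  · exact hBint.mono' (hmeas hF s₀)
      (Filter.Eventually.of_forall (hbound hFC s₀ (mem_of_mem_nhds hU)))
  · exact Filter.Eventually.of_forall fun y s hs => hbound hF'C s hs y
  · exact Filter.Eventually.of_forall fun y s hs => (hd s hs y).mul_const _

lemma abs_deriv_weight_le {t₀ t : ℝ} (ht₀ : 0 < t₀) (ht : t₀ / 2 ≤ t) (z : ℝ) :
    1 ≤ (1 + 1 / t₀ + 1 / t₀ ^ 2) * (1 + z ^ 2) ∧
    |-z / (2 * t)| ≤ (1 + 1 / t₀ + 1 / t₀ ^ 2) * (1 + z ^ 2) ∧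
    |z ^ 2 / (4 * t ^ 2) - 1 / (2 * t)| ≤ (1 + 1 / t₀ + 1 / t₀ ^ 2) * (1 + z ^ 2) := by
  have htp : 0 < t := by linarith
  have h1 : 1 / (2 * t) ≤ 1 / t₀ := by
    gcongr
    linarith
  have h1' : 0 ≤ 1 / (2 * t) := by positivity
  have h2 : 1 / (4 * t ^ 2) ≤ 1 / t₀ ^ 2 := by
    gcongr
    nlinarith
  have h2' : 0 ≤ 1 / (4 * t ^ 2) := by positivity
  have e1 : |z| ≤ 1 + z ^ 2 := by
    rw [← sq_abs]
    nlinarith [sq_nonneg (|z| - 1), abs_nonneg z]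
  have e2 : |-z / (2 * t)| = |z| * (1 / (2 * t)) := by
    rw [abs_div, abs_neg, abs_of_pos (by positivity : 0 < 2 * t)]
    ring
  have e3 : z ^ 2 / (4 * t ^ 2) = z ^ 2 * (1 / (4 * t ^ 2)) := by ring
  have h0 : 0 ≤ z ^ 2 := sq_nonneg z
  generalize 1 / (2 * t) = a at *
  generalize 1 / (4 * t ^ 2) = b at *
  generalize 1 / t₀ ^ 2 = d at *
  generalize 1 / t₀ = c at *
  have hc : 0 ≤ c := h1'.trans h1
  have hd : 0 ≤ d := h2'.trans h2
  have p1 := mul_nonneg hc h0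
  have p2 := mul_nonneg hd h0
  refine ⟨by nlinarith, ?_, ?_⟩
  · rw [e2]
    calc |z| * a ≤ (1 + z ^ 2) * c := by gcongr
      _ ≤ _ := by nlinarith
  · rw [e3, abs_le]
    have := mul_le_mul_of_nonneg_left h2 h0
    have := mul_nonneg h0 h2'
    constructor <;> nlinarith

/-- The Poisson integral of a bounded continuous function. -/
noncomputable def heatSolution (f : ℝ → ℝ) (x t : ℝ) : ℝ := ∫ y, heatKernel (x - y) t * f y

section heatSolution

variable {f : ℝ → ℝ} {M : ℝ}

lemma continuousAt_heatSolution (hf : Continuous f) (hM : ∀ x, |f x| ≤ M) {x t : ℝ} (ht : 0 < t) :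
    ContinuousAt (fun p : ℝ × ℝ => heatSolution f p.1 p.2) (x, t) := by
  obtain ⟨B, hB, hle⟩ := exists_integrable_bound_heatKernel ht x
  unfold heatSolution
  refine continuousAt_of_dominated (bound := fun y => B y * M) ?_ ?_ (hB.mul_const M) ?_
  · refine Filter.Eventually.of_forall fun p => ?_
    exact (((continuous_heatKernel p.2).comp (continuous_const.sub continuous_id)).mul
      hf).aestronglyMeasurable
  · have hU : Metric.closedBall x 1 ×ˢ Set.Icc (t / 2) (2 * t) ∈ 𝓝 (x, t) :=
      prod_mem_nhds (Metric.closedBall_mem_nhds x one_pos)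
        (Icc_mem_nhds (by linarith) (by linarith))
    filter_upwards [hU] with p hp
    refine Filter.Eventually.of_forall fun y => ?_
    have h1 := hle p.1 p.2 y (by simpa [Real.dist_eq] using hp.1) hp.2.1 hp.2.2
    have h2 := heatKernel_nonneg (p.1 - y) p.2
    have h3 : |heatKernel (p.1 - y) p.2| ≤ B y := by
      rw [abs_of_nonneg h2]
      nlinarith [mul_nonneg (sq_nonneg (p.1 - y)) h2]
    rw [norm_mul]
    exact mul_le_mul h3 (hM y) (abs_nonneg _) ((abs_nonneg _).trans h3)
  · refine Filter.Eventually.of_forall fun y => ?_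
    have h1 : ContinuousAt (fun p : ℝ × ℝ => (p.1 - y, p.2)) (x, t) := by fun_prop
    exact ((continuousAt_heatKernel ht (x - y)).comp (f := fun p : ℝ × ℝ => (p.1 - y, p.2))
      h1).mul continuousAt_const

lemma mul_heatKernel_le {a b z t : ℝ} (h : |a| ≤ b) : |a * heatKernel z t| ≤ b * heatKernel z t := by
  rw [abs_mul, abs_of_nonneg (heatKernel_nonneg z t)]
  exact mul_le_mul_of_nonneg_right h (heatKernel_nonneg z t)

lemma hasDerivAt_heatSolution_space (hf : Continuous f) (hM : ∀ x, |f x| ≤ M) {t : ℝ} (ht : 0 < t)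
    (x : ℝ) :
    HasDerivAt (fun x => heatSolution f x t)
      (∫ y, -(x - y) / (2 * t) * heatKernel (x - y) t * f y) x := by
  refine hasDerivAt_integral_of_le_heatKernel hf hM ht x (X := id) (T := fun _ => t)
    (C := 1 + 1 / t + 1 / t ^ 2) (F := fun s y => heatKernel (s - y) t)
    (F' := fun s y => -(s - y) / (2 * t) * heatKernel (s - y) t)
    (Metric.closedBall_mem_nhds x one_pos) (fun s hs => by simpa [Real.dist_eq] using hs)
    (fun _ _ => by linarith) (fun _ _ => by linarith) ?_ ?_ ?_ ?_ ?_
  · intro s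
    exact (continuous_heatKernel t).comp (by fun_prop)
  · intro s
    have := (continuous_heatKernel t).comp (by fun_prop : Continuous fun y => s - y)
    exact Continuous.mul (by fun_prop) this
  · intro s _ y
    rw [← mul_assoc]
    simpa using mul_heatKernel_le (a := 1) (z := s - y) (t := t)
      (by simpa using (abs_deriv_weight_le ht (by linarith : t / 2 ≤ t) (s - y)).1)
  · intro s _ y
    rw [← mul_assoc]
    exact mul_heatKernel_le (abs_deriv_weight_le ht (by linarith : t / 2 ≤ t) (s - y)).2.1
  · intro s _ y
    exact (hasDerivAt_heatKernel_space ht (s - y)).comp_sub_const s y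

lemma hasDerivAt_deriv_heatSolution_space (hf : Continuous f) (hM : ∀ x, |f x| ≤ M) {t : ℝ}
    (ht : 0 < t) (x : ℝ) :
    HasDerivAt (fun x => ∫ y, -(x - y) / (2 * t) * heatKernel (x - y) t * f y)
      (∫ y, ((x - y) ^ 2 / (4 * t ^ 2) - 1 / (2 * t)) * heatKernel (x - y) t * f y) x := by
  refine hasDerivAt_integral_of_le_heatKernel hf hM ht x (X := id) (T := fun _ => t)
    (C := 1 + 1 / t + 1 / t ^ 2) (F := fun s y => -(s - y) / (2 * t) * heatKernel (s - y) t)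
    (F' := fun s y => ((s - y) ^ 2 / (4 * t ^ 2) - 1 / (2 * t)) * heatKernel (s - y) t)
    (Metric.closedBall_mem_nhds x one_pos) (fun s hs => by simpa [Real.dist_eq] using hs)
    (fun _ _ => by linarith) (fun _ _ => by linarith) ?_ ?_ ?_ ?_ ?_
  · intro s
    have := (continuous_heatKernel t).comp (by fun_prop : Continuous fun y => s - y)
    exact Continuous.mul (by fun_prop) this
  · intro s
    have := (continuous_heatKernel t).comp (by fun_prop : Continuous fun y => s - y)
    exact Continuous.mul (by fun_prop) this
  · intro s _ y
    rw [← mul_assoc]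
    exact mul_heatKernel_le (abs_deriv_weight_le ht (by linarith : t / 2 ≤ t) (s - y)).2.1
  · intro s _ y
    rw [← mul_assoc]
    exact mul_heatKernel_le (abs_deriv_weight_le ht (by linarith : t / 2 ≤ t) (s - y)).2.2
  · intro s _ y
    exact (hasDerivAt_deriv_heatKernel_space ht (s - y)).comp_sub_const s y

lemma hasDerivAt_heatSolution_time (hf : Continuous f) (hM : ∀ x, |f x| ≤ M) {t : ℝ} (ht : 0 < t)
    (x : ℝ) :
    HasDerivAt (fun t => heatSolution f x t)
      (∫ y, ((x - y) ^ 2 / (4 * t ^ 2) - 1 / (2 * t)) * heatKernel (x - y) t * f y) t := by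
  refine hasDerivAt_integral_of_le_heatKernel hf hM ht x (X := fun _ => x) (T := id)
    (C := 1 + 1 / t + 1 / t ^ 2) (F := fun s y => heatKernel (x - y) s)
    (F' := fun s y => ((x - y) ^ 2 / (4 * s ^ 2) - 1 / (2 * s)) * heatKernel (x - y) s)
    (Icc_mem_nhds (by linarith : t / 2 < t) (by linarith : t < 2 * t)) (fun _ _ => by simp)
    (fun s hs => hs.1) (fun s hs => hs.2) ?_ ?_ ?_ ?_ ?_
  · intro s
    exact (continuous_heatKernel s).comp (by fun_prop)
  · intro s
    have := (continuous_heatKernel s).comp (by fun_prop : Continuous fun y => x - y)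
    exact Continuous.mul (by fun_prop) this
  · intro s hs y
    rw [← mul_assoc]
    simpa using mul_heatKernel_le (a := 1) (z := x - y) (t := s)
      (by simpa using (abs_deriv_weight_le ht hs.1 (x - y)).1)
  · intro s hs y
    rw [← mul_assoc]
    exact mul_heatKernel_le (abs_deriv_weight_le ht hs.1 (x - y)).2.2
  · intro s hs y
    exact hasDerivAt_heatKernel_time (by linarith [hs.1]) (x - y)

lemma abs_heatSolution_le (hM : ∀ x, |f x| ≤ M) {t : ℝ} (ht : 0 < t) (x : ℝ) :
    |heatSolution f x t| ≤ M := by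
  have hint : Integrable fun z => heatKernel z t := by
    have := (integrable_exp_neg_mul_sq (by positivity : 0 < 1 / (4 * t))).const_mul
      (√(4 * π * t))⁻¹
    refine this.congr (Filter.Eventually.of_forall fun z => ?_)
    simp only [heatKernel]
    congr 2
    ring
  have hone : ∫ z, heatKernel z t = 1 := by
    have h := integral_gaussian (1 / (4 * t))
    have e : ∀ z : ℝ, heatKernel z t = (√(4 * π * t))⁻¹ * exp (-(1 / (4 * t)) * z ^ 2) := by
      intro z
      simp only [heatKernel]
      congr 2
      ring
    simp_rw [e]
    rw [integral_const_mul, h]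
    have : π / (1 / (4 * t)) = 4 * π * t := by
      field_simp
    rw [this, inv_mul_cancel₀ (by positivity)]
  calc |heatSolution f x t| ≤ ∫ y, heatKernel (x - y) t * M := by
        refine norm_integral_le_of_norm_le (f := fun y => heatKernel (x - y) t * f y)
          ((hint.comp_sub_left x).mul_const M)
          (Filter.Eventually.of_forall fun y => ?_)
        rw [norm_mul, Real.norm_eq_abs, abs_of_nonneg (heatKernel_nonneg _ _)]
        exact mul_le_mul_of_nonneg_left (hM y) (heatKernel_nonneg _ _)
    _ = M := by
        rw [integral_mul_const, integral_sub_left_eq_self (fun z => heatKernel z t), hone, one_mul]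

end heatSolution

open scoped unitInterval in
/-- If a path of scalars starts at `0`, then `z ↦ 1 - z * c 1` has a continuous logarithm on the set
of those `z` for which `1 - z * c s` never vanishes. -/
lemma exists_continuousOn_log_one_sub_mul (c : C(I, ℂ)) (hc : c 0 = 0) :
    ∃ L : ℂ → ℂ, ContinuousOn L {z | ∀ s, 1 - z * c s ≠ 0} ∧
      ∀ z ∈ {z | ∀ s, 1 - z * c s ≠ 0}, Complex.exp (L z) = 1 - z * c 1 := by
  set S : Set ℂ := {z | ∀ s, 1 - z * c s ≠ 0} with hS
  let H : C(I × S, {z : ℂ // z ≠ 0}) :=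
    ⟨fun p => ⟨1 - p.2 * c p.1, p.2.2 p.1⟩, by fun_prop⟩
  have H_0 : ∀ a : S, H (0, a) = ⟨Complex.exp ((0 : C(S, ℂ)) a), Complex.exp_ne_zero _⟩ := by
    intro a
    simp [H, hc]
  let F := Complex.isCoveringMap_exp.liftHomotopy H 0 H_0
  have hF : ∀ z : S, Complex.exp (F (1, z)) = 1 - z * c 1 := fun z =>
    congrArg Subtype.val
      (congrFun (Complex.isCoveringMap_exp.liftHomotopy_lifts H 0 H_0) (1, z))
  classical
  refine ⟨fun z => if h : z ∈ S then F (1, ⟨z, h⟩) else 0, ?_, ?_⟩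
  · rw [continuousOn_iff_continuous_domRestrict]
    have : S.domRestrict (fun z => if h : z ∈ S then F (1, ⟨z, h⟩) else 0) = fun z => F (1, z) := by
      ext z
      simp
    rw [this]
    fun_prop
  · intro z hz
    simp only [hz, dite_true]
    exact hF ⟨z, hz⟩

/-- The complement of a ray `A` going to infinity carries a continuous logarithm of
`z ↦ 1 - z / A 0`. -/
lemma exists_continuousOn_log_compl_ray (A : ℝ → ℂ) (hA : Continuous A) (hA0 : ∀ s, A s ≠ 0)
    (hlim : Filter.Tendsto A Filter.atTop (Filter.cocompact ℂ)) :
    ∃ L : ℂ → ℂ, ContinuousOn L (A '' Set.Ici 0)ᶜ ∧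
      ∀ z ∈ (A '' Set.Ici 0)ᶜ, Complex.exp (L z) = 1 - z * (A 0)⁻¹ := by
  classical
  let c : ℝ → ℂ := Function.update (fun s => (A (s⁻¹ - 1))⁻¹) 0 0
  have hc_ne : ∀ s, s ≠ 0 → c s = (A (s⁻¹ - 1))⁻¹ := fun s hs => by simp [c, hs]
  have hc : ContinuousOn c (Set.Icc 0 1) := by
    intro s hs
    rcases eq_or_ne s 0 with rfl | hs0
    · rw [continuousWithinAt_update_same]
      have h1 : Filter.Tendsto (fun s : ℝ => s⁻¹ - 1) (𝓝[>] 0) Filter.atTop :=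
        Filter.tendsto_atTop_add_const_right _ _ tendsto_inv_nhdsGT_zero
      have h2 := (Filter.tendsto_inv₀_cobounded (α := ℂ)).comp
        ((Metric.cobounded_eq_cocompact (α := ℂ) ▸ hlim).comp h1)
      refine h2.mono_left (nhdsWithin_mono _ ?_)
      rintro x ⟨hx, hx0⟩
      exact lt_of_le_of_ne hx.1 (Ne.symm hx0)
    · refine ContinuousAt.continuousWithinAt ?_
      rw [continuousAt_update_of_ne hs0]
      have : ContinuousAt (fun s : ℝ => A (s⁻¹ - 1)) s :=
        hA.continuousAt.comp ((continuousAt_inv₀ hs0).sub continuousAt_const)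
      exact this.inv₀ (hA0 _)
  let cI : C(unitInterval, ℂ) := ⟨fun s => c s, continuousOn_iff_continuous_domRestrict.1 hc⟩
  have hcI : ∀ s, cI s = c s := fun _ => rfl
  obtain ⟨L, hL, hexp⟩ := exists_continuousOn_log_one_sub_mul cI (by simp [hcI, c])
  have hsub : (A '' Set.Ici 0)ᶜ ⊆ {z | ∀ s : unitInterval, 1 - z * cI s ≠ 0} := by
    rintro z hz ⟨s, hs⟩ h
    rcases eq_or_ne s 0 with rfl | hs0
    · simp [hcI, c] at h
    · rw [hcI, hc_ne s hs0] at h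
      refine hz ⟨s⁻¹ - 1, ?_, ?_⟩
      · have : 1 ≤ s⁻¹ := (one_le_inv₀ (lt_of_le_of_ne hs.1 (Ne.symm hs0))).2 hs.2
        simpa using this
      · have := hA0 (s⁻¹ - 1)
        exact ((mul_inv_eq_one₀ this).1 (sub_eq_zero.1 h).symm).symm
  refine ⟨L, hL.mono hsub, fun z hz => ?_⟩
  rw [hexp z (hsub hz)]
  rw [hcI, hc_ne _ (by simp)]
  simp

/-- There is no continuous logarithm of `z ↦ 1 - z / a` on the punctured plane. -/
lemma not_continuousOn_log_compl_singleton (a : ℂ) (ha : a ≠ 0) (L : ℂ → ℂ)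
    (hL : ContinuousOn L {a}ᶜ) (hexp : ∀ z ∈ ({a} : Set ℂ)ᶜ, Complex.exp (L z) = 1 - z * a⁻¹) :
    False := by
  have hmem : ∀ θ : ℝ, a + Complex.exp (θ * Complex.I) ∈ ({a} : Set ℂ)ᶜ := fun θ => by simp
  let g : ℝ → ℂ := fun θ => L (a + Complex.exp (θ * Complex.I)) - θ * Complex.I
  have hg : Continuous g :=
    (hL.comp_continuous (by fun_prop) hmem).sub (by fun_prop)
  have hconst : g = fun _ => g 0 := by
    refine Complex.isCoveringMap_exp.eq_of_comp_eq hg continuous_const ?_ 0 rfl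
    have key : ∀ θ, Complex.exp (g θ) = -a⁻¹ := fun θ => by
      simp only [g]
      rw [Complex.exp_sub, hexp _ (hmem θ)]
      have := Complex.exp_ne_zero (θ * Complex.I)
      field_simp
      ring
    ext θ
    simp [key]
  have h := congrFun hconst (2 * π)
  simp [g, Complex.exp_two_pi_mul_I] at h

/-- A properly embedded line separates the plane. -/
lemma not_isPreconnected_compl_range (A : ℝ → ℂ) (hA : Continuous A) (hinj : Function.Injective A)
    (hA0 : ∀ s, A s ≠ 0) (hlim : Filter.Tendsto A (Filter.cocompact ℝ) (Filter.cocompact ℂ)) :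
    ¬ IsPreconnected (Set.range A)ᶜ := by
  classical
  intro hconn
  have hprop : IsProperMap A := isProperMap_iff_tendsto_cocompact.2 ⟨hA, hlim⟩
  obtain ⟨L₁, hL₁, hexp₁⟩ := exists_continuousOn_log_compl_ray A hA hA0
    (hlim.mono_left atTop_le_cocompact)
  obtain ⟨L₂, hL₂, hexp₂⟩ := exists_continuousOn_log_compl_ray (fun s => A (-s))
    (hA.comp continuous_neg) (fun s => hA0 _)
    ((hlim.mono_left atBot_le_cocompact).comp Filter.tendsto_neg_atTop_atBot)
  have himg : (fun s => A (-s)) '' Set.Ici 0 = A '' Set.Iic 0 := by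
    rw [← Set.image_image A (fun s => -s)]
    simp
  rw [himg] at hL₂ hexp₂
  simp only [neg_zero] at hexp₂
  set S₁ := (A '' Set.Ici 0)ᶜ with hS₁
  set S₂ := (A '' Set.Iic 0)ᶜ with hS₂
  have ho₁ : IsOpen S₁ := (hprop.isClosedMap _ isClosed_Ici).isOpen_compl
  have ho₂ : IsOpen S₂ := (hprop.isClosedMap _ isClosed_Iic).isOpen_compl
  have hinter : S₁ ∩ S₂ = (Set.range A)ᶜ := by
    rw [hS₁, hS₂, ← Set.compl_union, ← Set.image_union, Set.union_comm, Set.Iic_union_Ici,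
      Set.image_univ]
  have hunion : ({A 0} : Set ℂ)ᶜ ⊆ S₁ ∪ S₂ := by
    intro z hz
    by_contra h
    simp only [hS₁, hS₂, Set.mem_union, Set.mem_compl_iff, not_or, not_not] at h
    obtain ⟨⟨s, hs, rfl⟩, t, ht, hst⟩ := h
    obtain rfl := hinj hst
    exact hz (congrArg A (le_antisymm ht hs))
  have h0 : (0 : ℂ) ∈ (Set.range A)ᶜ := by
    rintro ⟨s, hs⟩
    exact hA0 s hs
  have hdiff : ∀ z ∈ S₁ ∩ S₂, L₁ z = L₂ z + (L₁ 0 - L₂ 0) := by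
    rw [hinter]
    have hc : ContinuousOn (fun z => L₁ z - L₂ z) (Set.range A)ᶜ :=
      (hL₁.mono (hinter ▸ Set.inter_subset_left)).sub (hL₂.mono (hinter ▸ Set.inter_subset_right))
    have := isPreconnected_iff_preconnectedSpace.1 hconn
    have key : ∀ z ∈ (Set.range A)ᶜ, Complex.exp (L₁ z - L₂ z) = 1 := by
      rw [← hinter]
      rintro z hz
      rw [Complex.exp_sub, hexp₁ z hz.1, ← hexp₂ z hz.2, div_self (Complex.exp_ne_zero _)]
    have h := Complex.isCoveringMap_exp.eq_of_comp_eq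
      (continuousOn_iff_continuous_domRestrict.1 hc)
      (continuous_const (y := L₁ 0 - L₂ 0)) (by ext z; simp [key z z.2, key 0 h0]) ⟨0, h0⟩ rfl
    intro z hz
    have := congrFun h ⟨z, hz⟩
    simp only [Set.domRestrict_apply] at this
    rw [← this]
    ring
  let L : ℂ → ℂ := fun z => if z ∈ S₁ then L₁ z else L₂ z + (L₁ 0 - L₂ 0)
  have hL_1 : ∀ z ∈ S₁, L z = L₁ z := fun z hz => by simp [L, hz]
  have hL_2 : ∀ z ∈ S₂, L z = L₂ z + (L₁ 0 - L₂ 0) := fun z hz => by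
    by_cases h : z ∈ S₁
    · rw [hL_1 z h, hdiff z ⟨h, hz⟩]
    · simp [L, h]
  have hone : Complex.exp (L₁ 0 - L₂ 0) = 1 := by
    rw [← hinter] at h0
    rw [Complex.exp_sub, hexp₁ 0 h0.1, hexp₂ 0 h0.2, zero_mul, sub_zero, div_one]
  refine not_continuousOn_log_compl_singleton (A 0) (hA0 0) L ?_ ?_
  · intro z hz
    refine ContinuousAt.continuousWithinAt ?_
    rcases hunion hz with h | h
    · exact (hL₁.continuousAt (ho₁.mem_nhds h)).congr
        (Filter.eventuallyEq_of_mem (ho₁.mem_nhds h) fun w hw => (hL_1 w hw).symm)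
    · exact ((hL₂.continuousAt (ho₂.mem_nhds h)).add continuousAt_const).congr
        (Filter.eventuallyEq_of_mem (ho₂.mem_nhds h) fun w hw => (hL_2 w hw).symm)
  · intro z hz
    rcases hunion hz with h | h
    · rw [hL_1 z h, hexp₁ z h]
    · rw [hL_2 z h, Complex.exp_add, hone, mul_one, hexp₂ z h]

/-- The necessary second-order condition at a local maximum. -/
lemma nonpos_second_deriv_of_isLocalMax {g g' : ℝ → ℝ} {a c : ℝ}
    (hg : ∀ x, HasDerivAt g (g' x) x) (hg' : HasDerivAt g' c a) (hmax : IsLocalMax g a) :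
    c ≤ 0 := by
  by_contra! hc
  have hd : deriv g = g' := funext fun x => (hg x).deriv
  have hmin : IsLocalMin g a := isLocalMin_of_deriv_deriv_pos (by rw [hd, hg'.deriv]; exact hc)
    hmax.deriv_eq_zero (hg a).continuousAt
  have hconst : g =ᶠ[𝓝 a] fun _ => g a := by
    filter_upwards [hmin, hmax] with x h1 h2 using le_antisymm h2 h1
  have h := hconst.deriv.deriv_eq
  rw [hd, hg'.deriv] at h
  simp at h
  exact hc.ne' h

/-- The derivative is nonnegative at a point which is a maximum from the left. -/
lemma nonneg_deriv_of_eventually_le_left {g : ℝ → ℝ} {a c : ℝ} (hg : HasDerivAt g c a)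
    (hmax : ∀ᶠ s in 𝓝[<] a, g s ≤ g a) : 0 ≤ c := by
  have hlim : Filter.Tendsto (slope g a) (𝓝[<] a) (𝓝 c) :=
    hg.tendsto_slope.mono_left (nhdsWithin_mono a fun x (hx : x < a) => hx.ne)
  refine ge_of_tendsto hlim ?_
  filter_upwards [hmax, self_mem_nhdsWithin] with s hs hsa
  rw [slope_def_field]
  exact div_nonneg_of_nonpos (by linarith) (by linarith [Set.mem_Iio.1 hsa])

/-- The maximum principle for solutions of the heat equation bounded above, on a domain whose whole
boundary lies in the open upper half-plane. -/
lemma heat_nonpos_of_frontier_nonpos {w wx wxx : ℝ → ℝ → ℝ} {M : ℝ}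
    (hx : ∀ x t, 0 < t → HasDerivAt (fun x => w x t) (wx x t) x)
    (hxx : ∀ x t, 0 < t → HasDerivAt (fun x => wx x t) (wxx x t) x)
    (ht : ∀ x t, 0 < t → HasDerivAt (fun t => w x t) (wxx x t) t)
    (hc : ∀ x t, 0 < t → ContinuousAt (fun p : ℝ × ℝ => w p.1 p.2) (x, t))
    (hM : ∀ x t, 0 < t → w x t ≤ M) {Ω : Set (ℝ × ℝ)} (hΩ : IsOpen Ω)
    (hpos : ∀ p ∈ closure Ω, 0 < p.2) (hfr : ∀ p ∈ frontier Ω, w p.1 p.2 ≤ 0) :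
    ∀ p ∈ Ω, w p.1 p.2 ≤ 0 := by
  rintro ⟨x₀, t₀⟩ hp
  by_contra! hw
  have hp' := subset_closure hp
  have ht₀ : 0 < t₀ := hpos _ hp'
  have hD : 0 < x₀ ^ 2 + 3 * t₀ := by positivity
  simp only at hw
  obtain ⟨ε, hε, hεw⟩ : ∃ ε > 0, ε * (x₀ ^ 2 + 3 * t₀) < w x₀ t₀ := by
    refine ⟨w x₀ t₀ / (2 * (x₀ ^ 2 + 3 * t₀)), by positivity, ?_⟩
    rw [div_mul_eq_mul_div, div_lt_iff₀ (by positivity)]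
    nlinarith [mul_pos hw hD]
  set R := |x₀| + 1 + |M| / ε with hR
  have hdiv : 0 ≤ |M| / ε := by positivity
  have hR1 : 1 ≤ R := by linarith [abs_nonneg x₀]
  have hRM : M ≤ ε * R ^ 2 := by
    have h1 : |M| / ε ≤ R := by linarith [abs_nonneg x₀]
    rw [div_le_iff₀ hε] at h1
    nlinarith [le_abs_self M, mul_nonneg hε.le (by nlinarith : 0 ≤ R ^ 2 - R)]
  let v : ℝ × ℝ → ℝ := fun p => w p.1 p.2 - ε * (p.1 ^ 2 + 3 * p.2)
  let K : Set (ℝ × ℝ) := closure Ω ∩ {q | |q.1| ≤ R ∧ q.2 ≤ t₀}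
  have hKc : IsCompact K := by
    refine IsCompact.of_isClosed_subset (isCompact_Icc (a := -R) (b := R) |>.prod
      (isCompact_Icc (a := 0) (b := t₀))) ?_ ?_
    · have h1 : IsClosed {q : ℝ × ℝ | |q.1| ≤ R} := isClosed_le (by fun_prop) (by fun_prop)
      have h2 : IsClosed {q : ℝ × ℝ | q.2 ≤ t₀} := isClosed_le (by fun_prop) (by fun_prop)
      exact isClosed_closure.inter (h1.inter h2)
    · rintro q ⟨h1, h2, h3⟩
      exact ⟨abs_le.1 h2, (hpos q h1).le, h3⟩
  have hpK : (x₀, t₀) ∈ K := ⟨hp', by simp only; linarith [abs_nonneg x₀], le_rfl⟩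
  have hvc : ContinuousOn v K := by
    rintro ⟨x, t⟩ hq
    have := hc x t (hpos _ hq.1)
    exact (this.sub (by fun_prop)).continuousWithinAt
  obtain ⟨⟨x, t⟩, hq, hmax⟩ := hKc.exists_isMaxOn ⟨_, hpK⟩ hvc
  have htpos : 0 < t := hpos _ hq.1
  have hvq : 0 < w x t - ε * (x ^ 2 + 3 * t) := by
    have h1 : v (x₀, t₀) ≤ v (x, t) := hmax hpK
    simp only [v] at h1
    linarith
  have hqΩ : (x, t) ∈ Ω := by
    by_contra hn
    have h1 := hfr (x, t) (hΩ.frontier_eq ▸ ⟨hq.1, hn⟩)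
    have h2 : 0 ≤ ε * (x ^ 2 + 3 * t) := by positivity
    simp only at h1
    linarith
  have hxR : |x| < R := by
    refine lt_of_le_of_ne hq.2.1 fun h => ?_
    have h1 : x ^ 2 = R ^ 2 := by rw [← h, sq_abs]
    rw [h1] at hvq
    have h2 := hM x t htpos
    nlinarith [mul_pos hε htpos]
  have hloc : ∀ᶠ q in 𝓝 (x, t), q.2 ≤ t → v q ≤ v (x, t) := by
    have hopen : IsOpen {q : ℝ × ℝ | |q.1| < R} := isOpen_lt (by fun_prop) (by fun_prop)
    filter_upwards [hΩ.mem_nhds hqΩ, hopen.mem_nhds hxR] with q h1 h2 h3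
    exact hmax ⟨subset_closure h1, le_of_lt h2, h3.trans hq.2.2⟩
  have hspace : wxx x t - 2 * ε ≤ 0 := by
    refine nonpos_second_deriv_of_isLocalMax (g := fun x => v (x, t))
      (g' := fun x => wx x t - 2 * ε * x) (a := x) (fun y => ?_) ?_ ?_
    · have h := (((hasDerivAt_id y).pow 2).add_const (3 * t)).const_mul ε
      refine ((hx y t htpos).sub h).congr_deriv ?_
      simp
      ring
    · refine ((hxx x t htpos).sub ((hasDerivAt_id x).const_mul (2 * ε))).congr_deriv ?_
      simp
    · have hcont : ContinuousAt (fun y : ℝ => (y, t)) x := by fun_prop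
      filter_upwards [hcont.eventually hloc] with y hy
      exact hy le_rfl
  have htime : 0 ≤ wxx x t - 3 * ε := by
    refine nonneg_deriv_of_eventually_le_left (g := fun s => v (x, s)) (a := t) ?_ ?_
    · have h := (((hasDerivAt_id t).const_mul 3).const_add (x ^ 2)).const_mul ε
      refine ((ht x t htpos).sub h).congr_deriv ?_
      simp
      ring
    · have hcont : ContinuousAt (fun s : ℝ => (x, s)) t := by fun_prop
      filter_upwards [(hcont.eventually hloc).filter_mono nhdsWithin_le_nhds, self_mem_nhdsWithin]
        with s hs hst
      exact hs (le_of_lt hst)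
  linarith

/-- A Poisson integral vanishing on the boundary of a domain, the boundary lying in the open upper
half-plane, vanishes on that domain. -/
lemma heatSolution_eq_zero_of_frontier {f : ℝ → ℝ} {M : ℝ} (hf : Continuous f)
    (hM : ∀ x, |f x| ≤ M) {Ω : Set (ℝ × ℝ)} (hΩ : IsOpen Ω) (hpos : ∀ p ∈ closure Ω, 0 < p.2)
    (hfr : ∀ p ∈ frontier Ω, heatSolution f p.1 p.2 = 0) :
    ∀ p ∈ Ω, heatSolution f p.1 p.2 = 0 := by
  intro p hp
  refine le_antisymm ?_ ?_
  · exact heat_nonpos_of_frontier_nonpos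
      (fun x t ht => hasDerivAt_heatSolution_space hf hM ht x)
      (fun x t ht => hasDerivAt_deriv_heatSolution_space hf hM ht x)
      (fun x t ht => hasDerivAt_heatSolution_time hf hM ht x)
      (fun x t ht => continuousAt_heatSolution hf hM ht)
      (fun x t ht => (le_abs_self _).trans (abs_heatSolution_le hM ht x)) hΩ hpos
      (fun p hp => (hfr p hp).le) p hp
  · have h := heat_nonpos_of_frontier_nonpos (w := fun x t => -heatSolution f x t)
      (fun x t ht => (hasDerivAt_heatSolution_space hf hM ht x).fun_neg)
      (fun x t ht => (hasDerivAt_deriv_heatSolution_space hf hM ht x).fun_neg)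
      (fun x t ht => (hasDerivAt_heatSolution_time hf hM ht x).fun_neg)
      (fun x t ht => (continuousAt_heatSolution hf hM ht).fun_neg)
      (fun x t ht => (neg_le_abs _).trans (abs_heatSolution_le hM ht x)) hΩ hpos
      (fun p hp => by simp [hfr p hp]) p hp
    simpa using h

/-- The frontier of a component of an open set lies outside of that set. -/
lemma frontier_connectedComponentIn_subset {X : Type*} [TopologicalSpace X]
    [LocallyConnectedSpace X] {U : Set X} (hU : IsOpen U) (x : X) :
    frontier (connectedComponentIn U x) ⊆ Uᶜ := by
  intro y hy hyU
  rw [hU.connectedComponentIn.frontier_eq] at hy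
  obtain ⟨z, hz, hzx⟩ := mem_closure_iff.1 hy.1 _ hU.connectedComponentIn
    (mem_connectedComponentIn hyU)
  refine hy.2 ?_
  rw [connectedComponentIn_eq hzx, ← connectedComponentIn_eq hz]
  exact mem_connectedComponentIn hyU

/-- A properly embedded line in the open upper half-plane which is closed in the plane cuts off a
domain whose boundary is contained in the line. -/
lemma exists_domain_of_isClosed (Γ : ℝ → {p : ℝ × ℝ // 0 < p.2}) (hΓ : IsProperMap Γ)
    (hinj : Function.Injective Γ) {γ : Set (ℝ × ℝ)} (hγ : γ = Subtype.val '' Set.range Γ)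
    (hclosed : IsClosed γ) :
    ∃ Ω : Set (ℝ × ℝ), IsOpen Ω ∧ IsPreconnected Ω ∧ Ω.Nonempty ∧ Disjoint Ω γ ∧
      frontier Ω ⊆ γ ∧ ∀ p ∈ closure Ω, 0 < p.2 := by
  have hγpos : ∀ p ∈ γ, 0 < p.2 := by
    rw [hγ]
    rintro _ ⟨q, -, rfl⟩
    exact q.2
  have hproper : IsProperMap fun s => (Γ s : ℝ × ℝ) := by
    rw [isProperMap_iff_isCompact_preimage] at hΓ ⊢
    refine ⟨continuous_subtype_val.comp hΓ.1, fun K hK => ?_⟩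
    have h1 : IsCompact (Subtype.val ⁻¹' (K ∩ γ) : Set {p : ℝ × ℝ // 0 < p.2}) := by
      rw [Subtype.isCompact_iff, Set.image_preimage_eq_of_subset]
      · exact hK.inter_right hclosed
      · exact fun p hp => ⟨⟨p, hγpos p hp.2⟩, rfl⟩
    convert hΓ.2 h1 using 1
    ext s
    simp [hγ]
  have hrange : γ = Set.range fun s => (Γ s : ℝ × ℝ) := by
    rw [hγ, ← Set.range_comp]
    rfl
  let e := Complex.equivRealProdCLM.symm.toHomeomorph
  have hsep : ¬ IsPreconnected γᶜ := by
    intro h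
    have h2 := h.image e e.continuous.continuousOn
    rw [Set.image_compl_eq e.bijective, hrange, ← Set.range_comp] at h2
    refine not_isPreconnected_compl_range _ (e.continuous.comp hproper.continuous)
      (e.injective.comp (Subtype.val_injective.comp hinj)) (fun s hs => ?_) ?_ h2
    · have h3 : (Γ s : ℝ × ℝ) = 0 := by simpa [e] using hs
      have h4 := (Γ s).2
      rw [h3] at h4
      exact lt_irrefl _ h4
    · exact (isProperMap_iff_tendsto_cocompact.1 (e.isProperMap.comp hproper)).2
  have hH : {p : ℝ × ℝ | p.2 ≤ 0} ⊆ γᶜ := fun p hp hpγ => (hγpos p hpγ).not_ge hp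
  have hHconn : IsPreconnected {p : ℝ × ℝ | p.2 ≤ 0} :=
    (convex_halfSpace_le (LinearMap.snd ℝ ℝ ℝ).isLinear 0).isPreconnected
  have hHW : {p : ℝ × ℝ | p.2 ≤ 0} ⊆ connectedComponentIn γᶜ 0 :=
    hHconn.subset_connectedComponentIn (by simp) hH
  obtain ⟨q, hq, hqW⟩ : ∃ q ∈ γᶜ, q ∉ connectedComponentIn γᶜ (0 : ℝ × ℝ) := by
    by_contra! h
    exact hsep ((connectedComponentIn_subset _ _).antisymm h ▸ isPreconnected_connectedComponentIn)
  have hfr := frontier_connectedComponentIn_subset hclosed.isOpen_compl q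
  rw [compl_compl] at hfr
  refine ⟨connectedComponentIn γᶜ q, hclosed.isOpen_compl.connectedComponentIn,
    isPreconnected_connectedComponentIn, ⟨q, mem_connectedComponentIn hq⟩,
    Set.disjoint_left.2 fun p hp => connectedComponentIn_subset _ _ hp, hfr, fun p hp => ?_⟩
  by_cases hpq : p ∈ connectedComponentIn γᶜ q
  · by_contra! hp0
    have h1 := connectedComponentIn_eq hpq
    rw [← connectedComponentIn_eq (hHW hp0)] at h1
    exact hqW (h1 ▸ mem_connectedComponentIn hq)
  · exact hγpos p (hfr (hclosed.isOpen_compl.connectedComponentIn.frontier_eq ▸ ⟨hp, hpq⟩))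

/-- **Theorem 2.** A nodal curve of a (nontrivial) bounded solution of the heat
equation on the half-plane has an end point on the line `{t = 0}`. -/
theorem heat_nodal_curve_endpoint
    (f : ℝ → ℝ) (hf_cont : Continuous f) (M : ℝ) (hf_bdd : ∀ x, |f x| ≤ M)
    (u : ℝ → ℝ → ℝ)
    (hu : ∀ x t, 0 < t →
      u x t = (Real.sqrt (4 * Real.pi * t))⁻¹ *
        ∫ y : ℝ, Real.exp (-((x - y) ^ 2) / (4 * t)) * f y)
    (hu0 : ∀ x, u x 0 = f x)
    (hf_ne : ∃ x, f x ≠ 0)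
    (γ : Set (ℝ × ℝ))
    (Z : Set (ℝ × ℝ)) (hZ : Z = {p : ℝ × ℝ | 0 < p.2 ∧ u p.1 p.2 = 0})
    (hcomp : ∃ p ∈ Z, γ = connectedComponentIn Z p)
    (Γ : ℝ → {p : ℝ × ℝ // 0 < p.2})
    (hΓ_proper : IsProperMap Γ) (hΓ_inj : Function.Injective Γ)
    (hΓ_range : γ = Subtype.val '' Set.range Γ) :
    ∃ x₀ : ℝ, (x₀, (0 : ℝ)) ∈ closure γ := by
  by_contra! hend
  have hus : ∀ x t, 0 < t → u x t = heatSolution f x t := fun x t ht => by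
    rw [hu x t ht, heatSolution, ← integral_const_mul]
    simp only [heatKernel, mul_assoc]
  have hγpos : ∀ p ∈ γ, 0 < p.2 := by
    rw [hΓ_range]
    rintro _ ⟨q, -, rfl⟩
    exact q.2
  have hclosed : IsClosed γ := by
    refine isClosed_of_closure_subset fun p hp => ?_
    have h0 : 0 ≤ p.2 := closure_minimal (fun q hq => (hγpos q hq).le)
      (isClosed_le continuous_const continuous_snd : IsClosed {q : ℝ × ℝ | 0 ≤ q.2}) hp
    have hp0 : 0 < p.2 := lt_of_le_of_ne h0 fun h => hend p.1 (by rw [h]; exact hp)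
    have h2 : (⟨p, hp0⟩ : {p : ℝ × ℝ // 0 < p.2}) ∈ closure (Set.range Γ) := by
      rw [closure_subtype, ← hΓ_range]
      exact hp
    rw [hΓ_proper.isClosedMap.isClosed_range.closure_eq] at h2
    rw [hΓ_range]
    exact ⟨_, h2, rfl⟩
  obtain ⟨Ω, hΩo, hΩc, ⟨q, hq⟩, hdisj, hfr, hpos⟩ :=
    exists_domain_of_isClosed Γ hΓ_proper hΓ_inj hΓ_range hclosed
  obtain ⟨p, hp, hγp⟩ := hcomp
  have hγZ : γ ⊆ Z := hγp ▸ connectedComponentIn_subset Z p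
  have hzero : ∀ p ∈ γ, heatSolution f p.1 p.2 = 0 := fun p hp => by
    have h := hγZ hp
    rw [hZ] at h
    rw [← hus _ _ h.1, h.2]
  have hvan := heatSolution_eq_zero_of_frontier hf_cont hf_bdd hΩo hpos
    fun p hp => hzero p (hfr hp)
  have hclZ : closure Ω ⊆ Z := by
    intro r hr
    rw [hZ]
    refine ⟨hpos r hr, ?_⟩
    rw [hus _ _ (hpos r hr)]
    by_cases hrΩ : r ∈ Ω
    · exact hvan r hrΩ
    · exact hzero r (hfr (hΩo.frontier_eq ▸ ⟨hr, hrΩ⟩))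
  obtain ⟨r, hr⟩ : (frontier Ω).Nonempty := by
    rw [nonempty_frontier_iff]
    refine ⟨⟨q, hq⟩, fun h => ?_⟩
    have := hpos (0, 0) (h ▸ subset_closure (Set.mem_univ _))
    exact lt_irrefl _ this
  have hrγ : γ = connectedComponentIn Z r := by
    have h1 := hfr hr
    rw [hγp] at h1 ⊢
    exact connectedComponentIn_eq h1
  have hsub := hΩc.closure.subset_connectedComponentIn (frontier_subset_closure hr) hclZ
  exact Set.disjoint_left.1 hdisj hq (hrγ ▸ hsub (subset_closure hq))
end

section
/- If u(x,1) = 0 for every x in the interval I = [0,1], then f(x) = 0 for all x ∈ ℝ (backward uniqueness for the heat equation from a segment). -/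
open MeasureTheory Real

open ProbabilityTheory in
/-- Two finite measures on `ℝ` with everywhere finite moment generating functions that coincide
near a point are equal. -/
theorem MeasureTheory.Measure.ext_of_mgf_eventuallyEq {μ ν : Measure ℝ}
    [IsFiniteMeasure μ] [IsFiniteMeasure ν]
    (hμ : integrableExpSet id μ = Set.univ) (hν : integrableExpSet id ν = Set.univ) {t₀ : ℝ}
    (h : mgf id μ =ᶠ[nhds t₀] mgf id ν) : μ = ν := by
  have hmgf : mgf id μ = mgf id ν := by
    have hμ' : AnalyticOnNhd ℝ (mgf id μ) Set.univ := by
      simpa [hμ] using analyticOnNhd_mgf (X := id) (μ := μ)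
    have hν' : AnalyticOnNhd ℝ (mgf id ν) Set.univ := by
      simpa [hν] using analyticOnNhd_mgf (X := id) (μ := ν)
    exact hμ'.eq_of_eventuallyEq hν' h
  have h_zero : μ = 0 ↔ ν = 0 := by
    have h0 := congrFun hmgf 0
    rw [mgf_zero', mgf_zero'] at h0
    rw [← Measure.measure_univ_eq_zero, ← Measure.measure_univ_eq_zero (μ := ν),
      ← measureReal_eq_zero_iff, ← measureReal_eq_zero_iff, h0]
  refine Measure.ext_of_complexMGF_id_eq (funext fun z ↦ ?_)
  exact eqOn_complexMGF_of_mgf' hmgf h_zero (by simp [hμ])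

open ProbabilityTheory in
/-- A bounded continuous function whose Laplace transform against a nondegenerate Gaussian measure
vanishes near a point is zero. -/
theorem eq_zero_of_eventually_integral_exp_mul_gaussianReal_eq_zero {m : ℝ} {v : NNReal}
    (hv : v ≠ 0) {f : ℝ → ℝ} (hf : Continuous f) {M : ℝ} (hM : ∀ x, |f x| ≤ M) {t₀ : ℝ}
    (h : ∀ᶠ t in nhds t₀, ∫ y, exp (t * y) * f y ∂(gaussianReal m v) = 0) : f = 0 := by
  have hlap : ∀ g : ℝ → ℝ, Continuous g → ∀ C, (∀ x, |g x| ≤ C) → ∀ t : ℝ,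
      Integrable (fun y ↦ exp (t * y) * g y) (gaussianReal m v) := fun g hg C hC t ↦
    (integrable_exp_mul_gaussianReal t).mul_bdd (c := C) hg.aestronglyMeasurable
      (ae_of_all _ fun x ↦ by simpa using hC x)
  have hmgf : ∀ g : ℝ → ℝ, Continuous g → (∀ x, 0 ≤ g x) → ∀ t : ℝ,
      mgf id ((gaussianReal m v).withDensity fun x ↦ ENNReal.ofReal (g x)) t =
        ∫ y, exp (t * y) * g y ∂(gaussianReal m v) := fun g hg h0 t ↦ by
    rw [mgf, integral_withDensity_eq_integral_toReal_smul (by fun_prop)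
      (ae_of_all _ fun _ ↦ ENNReal.ofReal_lt_top)]
    simp [h0, mul_comm]
  have hexp : ∀ g : ℝ → ℝ, Continuous g → (∀ x, 0 ≤ g x) → ∀ C, (∀ x, |g x| ≤ C) →
      integrableExpSet id ((gaussianReal m v).withDensity fun x ↦ ENNReal.ofReal (g x)) =
        Set.univ := fun g hg h0 C hC ↦ by
    refine Set.eq_univ_of_forall fun t ↦ ?_
    rw [integrableExpSet, Set.mem_ofPred_eq, integrable_withDensity_iff (by fun_prop)
      (ae_of_all _ fun _ ↦ ENNReal.ofReal_lt_top)]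
    simpa [h0] using hlap g hg C hC t
  have hfin : ∀ g : ℝ → ℝ, Continuous g → ∀ C, (∀ x, |g x| ≤ C) →
      IsFiniteMeasure ((gaussianReal m v).withDensity fun x ↦ ENNReal.ofReal (g x)) :=
    fun g hg C hC ↦ isFiniteMeasure_withDensity_ofReal
      (by simpa using (hlap g hg C hC 0).hasFiniteIntegral)
  have hM0 : 0 ≤ M := (abs_nonneg _).trans (hM 0)
  have hg : Continuous fun x ↦ f x + M := by fun_prop
  have hg0 : ∀ x, 0 ≤ f x + M := fun x ↦ by linarith [(abs_le.1 (hM x)).1]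
  have hgC : ∀ x, |f x + M| ≤ M + M := fun x ↦
    (abs_add_le _ _).trans (by rw [abs_of_nonneg hM0]; linarith [hM x])
  have hMC : ∀ _ : ℝ, |M| ≤ M := fun _ ↦ (abs_of_nonneg hM0).le
  have := hfin _ hg _ hgC
  have := hfin _ continuous_const _ hMC
  have heq : (gaussianReal m v).withDensity (fun x ↦ ENNReal.ofReal (f x + M)) =
      (gaussianReal m v).withDensity fun _ ↦ ENNReal.ofReal M := by
    refine Measure.ext_of_mgf_eventuallyEq (hexp _ hg hg0 _ hgC)
      (hexp _ continuous_const (fun _ ↦ hM0) _ hMC) (t₀ := t₀) ?_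
    filter_upwards [h] with t ht
    rw [hmgf _ hg hg0, hmgf _ continuous_const fun _ ↦ hM0]
    simp_rw [mul_add]
    rw [integral_add (hlap f hf M hM t) (hlap _ continuous_const _ hMC t), ht, zero_add]
  rw [withDensity_eq_iff_of_sigmaFinite (by fun_prop) (by fun_prop)] at heq
  have hae : f =ᵐ[volume] 0 := by
    filter_upwards [(gaussianReal_absolutelyContinuous' m hv).ae_eq heq] with x hx
    rw [ENNReal.ofReal_eq_ofReal_iff (hg0 x) hM0] at hx
    simpa using hx
  exact (hf.ae_eq_iff_eq volume continuous_zero).1 hae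

/-- **Backward uniqueness from a segment.** If the bounded solution of the heat
equation given by the Poisson formula vanishes on `[0,1] × {1}`, then the
initial data `f` vanishes identically. -/
theorem heat_backward_uniqueness_segment
    (f : ℝ → ℝ) (hf_cont : Continuous f) (M : ℝ) (hf_bdd : ∀ x, |f x| ≤ M)
    (u : ℝ → ℝ → ℝ)
    (hu : ∀ x t, 0 < t →
      u x t = (Real.sqrt (4 * Real.pi * t))⁻¹ *
        ∫ y : ℝ, Real.exp (-((x - y) ^ 2) / (4 * t)) * f y)
    (hu0 : ∀ x, u x 0 = f x)
    (hvanish : ∀ x ∈ Set.Icc (0 : ℝ) 1, u x 1 = 0) :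
    ∀ x : ℝ, f x = 0 := by
  refine congrFun (eq_zero_of_eventually_integral_exp_mul_gaussianReal_eq_zero (m := 0) (v := 2)
    (t₀ := 1 / 4) two_ne_zero hf_cont hf_bdd ?_)
  filter_upwards [Icc_mem_nhds (a := (0 : ℝ)) (b := 1 / 2) (by norm_num) (by norm_num)] with t ht
  have hu1 : u (2 * t) 1 = 0 := hvanish _ ⟨by linarith [ht.1], by linarith [ht.2]⟩
  rw [hu _ _ one_pos, ← integral_const_mul] at hu1
  rw [ProbabilityTheory.integral_gaussianReal_eq_integral_smul two_ne_zero]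
  refine Eq.trans ?_ ((congrArg (exp (t ^ 2) * ·) hu1).trans (mul_zero _))
  rw [← integral_const_mul]
  congr 1 with y
  have hsq : exp (-(y - 0) ^ 2 / (2 * 2)) * exp (t * y) =
      exp (t ^ 2) * exp (-((2 * t - y) ^ 2) / (4 * 1)) := by
    rw [← exp_add, ← exp_add]
    ring_nf
  have hc : 2 * π * 2 = 4 * π * 1 := by ring
  simp only [ProbabilityTheory.gaussianPDFReal, smul_eq_mul, NNReal.coe_ofNat, hc]
  linear_combination (√(4 * π * 1))⁻¹ * f y * hsq
end

section
/- Let v be subharmonic on Q, and let a₁, a₂, a₃, a₄ be real numbers such that v ≤ aᵢ on the edge γᵢ for i = 1,2,3,4. Then v(0,1) ≤ (a₁ + a₂ + a₃ + a₄)/4. -/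
open MeasureTheory Real

/-- A function `v` is subharmonic on an open set `Q ⊆ ℝ²` if it is continuous on the
closure of `Q` and satisfies the sub-mean-value inequality on every closed disc
contained in `Q`. -/
def SubharmonicOnSet (v : ℝ × ℝ → ℝ) (Q : Set (ℝ × ℝ)) : Prop :=
  ContinuousOn v (closure Q) ∧
  ∀ (p : ℝ × ℝ) (r : ℝ), 0 < r →
    {q : ℝ × ℝ | (q.1 - p.1) ^ 2 + (q.2 - p.2) ^ 2 ≤ r ^ 2} ⊆ Q →
    v p ≤ (2 * Real.pi)⁻¹ *
      ∫ θ in (0 : ℝ)..(2 * Real.pi), v (p.1 + r * Real.cos θ, p.2 + r * Real.sin θ)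

/-- A continuous function on a set is continuous along every circle contained in that set. -/
lemma ContinuousOn.continuous_circle {v : ℝ × ℝ → ℝ} {Q : Set (ℝ × ℝ)}
    (hv : ContinuousOn v (closure Q)) {p : ℝ × ℝ} {r : ℝ}
    (hQ : {q : ℝ × ℝ | (q.1 - p.1) ^ 2 + (q.2 - p.2) ^ 2 ≤ r ^ 2} ⊆ Q) :
    Continuous fun θ : ℝ ↦ v (p.1 + r * Real.cos θ, p.2 + r * Real.sin θ) := by
  refine hv.comp_continuous (by fun_prop) fun θ ↦ subset_closure (hQ ?_)
  simp only [Set.mem_ofPred_eq]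
  nlinarith [Real.sin_sq_add_cos_sq θ]

lemma SubharmonicOnSet.add {v w : ℝ × ℝ → ℝ} {Q : Set (ℝ × ℝ)}
    (hv : SubharmonicOnSet v Q) (hw : SubharmonicOnSet w Q) :
    SubharmonicOnSet (fun q ↦ v q + w q) Q := by
  refine ⟨hv.1.add hw.1, fun p r hr hQ ↦ ?_⟩
  rw [intervalIntegral.integral_add ((hv.1.continuous_circle hQ).intervalIntegrable _ _)
    ((hw.1.continuous_circle hQ).intervalIntegrable _ _), mul_add]
  exact add_le_add (hv.2 p r hr hQ) (hw.2 p r hr hQ)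

/-- Subharmonicity is preserved by a quarter turn about `(0, 1)`. -/
lemma SubharmonicOnSet.comp_quarter_turn {v : ℝ × ℝ → ℝ} {Q : Set (ℝ × ℝ)}
    (hv : SubharmonicOnSet v Q) (hR : ∀ q : ℝ × ℝ, (1 - q.2, 1 + q.1) ∈ Q ↔ q ∈ Q) :
    SubharmonicOnSet (fun q ↦ v (1 - q.2, 1 + q.1)) Q := by
  have hcont : Continuous fun q : ℝ × ℝ ↦ (1 - q.2, 1 + q.1) := by fun_prop
  constructor
  · refine hv.1.comp hcont.continuousOn ?_
    exact Set.MapsTo.closure (fun q hq ↦ (hR q).2 hq) hcont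
  · intro p r hr hQ
    refine (hv.2 (1 - p.2, 1 + p.1) r hr fun q hq ↦ ?_).trans_eq ?_
    · have h : (q.2 - 1, 1 - q.1) ∈ Q := by
        apply hQ
        simp only [Set.mem_ofPred_eq] at hq ⊢
        nlinarith
      simpa using (hR _).2 h
    · congr 1
      let g : ℝ → ℝ := fun θ ↦ v (1 - p.2 + r * Real.cos θ, 1 + p.1 + r * Real.sin θ)
      have hg : Function.Periodic g (2 * Real.pi) := fun θ ↦ by simp [g]
      have h := hg.intervalIntegral_add_eq 0 (Real.pi / 2)
      have h' := intervalIntegral.integral_comp_add_right (a := 0) (b := 2 * Real.pi) g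
        (Real.pi / 2)
      rw [zero_add] at h h'
      rw [add_comm (2 * Real.pi), ← h] at h'
      refine h'.symm.trans (intervalIntegral.integral_congr fun θ _ ↦ ?_)
      simp only [g, Real.cos_add_pi_div_two, Real.sin_add_pi_div_two]
      congr 2 <;> ring

/-- The weak maximum principle for subharmonic functions on bounded open sets. -/
lemma SubharmonicOnSet.le_of_frontier_le {v : ℝ × ℝ → ℝ} {Q : Set (ℝ × ℝ)}
    (hv : SubharmonicOnSet v Q) (hQo : IsOpen Q) (hQb : Bornology.IsBounded Q) {A : ℝ}
    (hA : ∀ q ∈ frontier Q, v q ≤ A) {p : ℝ × ℝ} (hp : p ∈ Q) : v p ≤ A := by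
  have hK : IsCompact (closure Q) := hQb.isCompact_closure
  have hn : Continuous fun q : ℝ × ℝ ↦ q.1 ^ 2 + q.2 ^ 2 := by fun_prop
  obtain ⟨C, hC⟩ := hK.bddAbove_image hn.continuousOn
  have hC' : ∀ q ∈ closure Q, q.1 ^ 2 + q.2 ^ 2 ≤ C := fun q hq ↦ hC ⟨q, hq, rfl⟩
  have hC0 : 0 ≤ C := (by positivity : 0 ≤ p.1 ^ 2 + p.2 ^ 2).trans (hC' p (subset_closure hp))
  refine le_of_forall_pos_le_add fun δ hδ ↦ ?_
  obtain ⟨ε, hε, hεC⟩ : ∃ ε : ℝ, 0 < ε ∧ ε * C ≤ δ := by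
    refine ⟨δ / (C + 1), by positivity, ?_⟩
    rw [div_mul_eq_mul_div, div_le_iff₀ (by positivity)]
    nlinarith
  obtain ⟨m, hm, hmax⟩ := hK.exists_isMaxOn ⟨p, subset_closure hp⟩
    (hv.1.add (continuousOn_const (c := ε) |>.mul hn.continuousOn))
  have hmax' : ∀ q ∈ closure Q,
      v q + ε * (q.1 ^ 2 + q.2 ^ 2) ≤ v m + ε * (m.1 ^ 2 + m.2 ^ 2) := fun q hq ↦ hmax hq
  by_cases hmQ : m ∈ Q
  · exfalso
    obtain ⟨ρ, hρ, hball⟩ := Metric.isOpen_iff.1 hQo m hmQ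
    have hdisc : {q : ℝ × ℝ | (q.1 - m.1) ^ 2 + (q.2 - m.2) ^ 2 ≤ (ρ / 2) ^ 2} ⊆ Q := by
      intro q hq
      simp only [Set.mem_ofPred_eq] at hq
      apply hball
      rw [Metric.mem_ball, Prod.dist_eq, Real.dist_eq, Real.dist_eq]
      have h1 : |q.1 - m.1| ≤ ρ / 2 :=
        abs_le_of_sq_le_sq (by nlinarith [sq_nonneg (q.2 - m.2)]) (by positivity)
      have h2 : |q.2 - m.2| ≤ ρ / 2 :=
        abs_le_of_sq_le_sq (by nlinarith [sq_nonneg (q.1 - m.1)]) (by positivity)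
      exact max_lt (by linarith) (by linarith)
    obtain ⟨r, hr, hdisc⟩ : ∃ r : ℝ, 0 < r ∧
        {q : ℝ × ℝ | (q.1 - m.1) ^ 2 + (q.2 - m.2) ^ 2 ≤ r ^ 2} ⊆ Q := ⟨ρ / 2, half_pos hρ, hdisc⟩
    have hle : ∫ θ in (0 : ℝ)..(2 * Real.pi), v (m.1 + r * Real.cos θ, m.2 + r * Real.sin θ) ≤
        ∫ θ in (0 : ℝ)..(2 * Real.pi),
          ((v m - ε * r ^ 2) - (2 * ε * r * m.1 * Real.cos θ + 2 * ε * r * m.2 * Real.sin θ)) := by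
      refine intervalIntegral.integral_mono_on Real.two_pi_pos.le
        ((hv.1.continuous_circle hdisc).intervalIntegrable _ _)
        (Continuous.intervalIntegrable (by fun_prop) _ _) fun θ _ ↦ ?_
      have hθ := Real.sin_sq_add_cos_sq θ
      have h := hmax' (m.1 + r * Real.cos θ, m.2 + r * Real.sin θ) <| subset_closure <| hdisc <| by
        simp only [Set.mem_ofPred_eq]
        nlinarith
      have hsq : (m.1 + r * Real.cos θ) ^ 2 + (m.2 + r * Real.sin θ) ^ 2 = m.1 ^ 2 + m.2 ^ 2 +
          r ^ 2 + (2 * r * m.1 * Real.cos θ + 2 * r * m.2 * Real.sin θ) := by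
        linear_combination r ^ 2 * hθ
      simp only [hsq] at h
      linarith
    rw [intervalIntegral.integral_sub (Continuous.intervalIntegrable (by fun_prop) _ _)
      (Continuous.intervalIntegrable (by fun_prop) _ _),
      intervalIntegral.integral_add (Continuous.intervalIntegrable (by fun_prop) _ _)
      (Continuous.intervalIntegrable (by fun_prop) _ _)] at hle
    simp only [intervalIntegral.integral_const_mul, intervalIntegral.integral_const, integral_cos,
      integral_sin, Real.sin_two_pi, Real.cos_two_pi, Real.sin_zero, Real.cos_zero, sub_self,
      mul_zero, add_zero, sub_zero, smul_eq_mul] at hle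
    have h := (hv.2 m r hr hdisc).trans
      (mul_le_mul_of_nonneg_left hle (inv_nonneg.2 Real.two_pi_pos.le))
    rw [inv_mul_cancel_left₀ Real.two_pi_pos.ne'] at h
    have : 0 < ε * r ^ 2 := by positivity
    linarith
  · have h := hmax' p (subset_closure hp)
    have hmA : v m ≤ A := hA m ⟨hm, fun h ↦ hmQ (interior_subset h)⟩
    have hp0 : 0 ≤ ε * (p.1 ^ 2 + p.2 ^ 2) := by positivity
    have := mul_le_mul_of_nonneg_left (hC' m hm) hε.le
    linarith

/-- **Lemma 2.** If `v` is subharmonic on the square `Q = (−1,1) × (0,2)` and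
`v ≤ aᵢ` on the four edges `γᵢ`, then `v(0,1) ≤ (a₁ + a₂ + a₃ + a₄)/4`. -/
theorem subharmonic_center_bound
    (v : ℝ × ℝ → ℝ)
    (hv : SubharmonicOnSet v (Set.Ioo (-1 : ℝ) 1 ×ˢ Set.Ioo (0 : ℝ) 2))
    (a₁ a₂ a₃ a₄ : ℝ)
    (h₁ : ∀ q ∈ Set.Icc (-1 : ℝ) 1 ×ˢ ({0} : Set ℝ), v q ≤ a₁)
    (h₂ : ∀ q ∈ ({1} : Set ℝ) ×ˢ Set.Icc (0 : ℝ) 2, v q ≤ a₂)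
    (h₃ : ∀ q ∈ Set.Icc (-1 : ℝ) 1 ×ˢ ({2} : Set ℝ), v q ≤ a₃)
    (h₄ : ∀ q ∈ ({-1} : Set ℝ) ×ˢ Set.Icc (0 : ℝ) 2, v q ≤ a₄) :
    v (0, 1) ≤ (a₁ + a₂ + a₃ + a₄) / 4 := by
  have hR : ∀ q : ℝ × ℝ, (1 - q.2, 1 + q.1) ∈ Set.Ioo (-1 : ℝ) 1 ×ˢ Set.Ioo (0 : ℝ) 2 ↔
      q ∈ Set.Ioo (-1 : ℝ) 1 ×ˢ Set.Ioo (0 : ℝ) 2 := by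
    intro q
    simp only [Set.mem_prod, Set.mem_Ioo]
    constructor <;> rintro ⟨⟨_, _⟩, _, _⟩ <;> refine ⟨⟨?_, ?_⟩, ?_, ?_⟩ <;> linarith
  have hv₁ := hv.comp_quarter_turn hR
  have hv₂ := hv₁.comp_quarter_turn hR
  have hv₃ := hv₂.comp_quarter_turn hR
  have key := (((hv.add hv₁).add hv₂).add hv₃).le_of_frontier_le (A := a₁ + a₂ + a₃ + a₄)
    (p := (0, 1)) (isOpen_Ioo.prod isOpen_Ioo)
    ((Metric.isBounded_Ioo _ _).prod (Metric.isBounded_Ioo _ _)) ?_ (by simp)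
  · norm_num at key
    linarith
  · rintro ⟨x, y⟩ hq
    rw [frontier_prod_eq, closure_Ioo (by norm_num), closure_Ioo (by norm_num),
      frontier_Ioo (by norm_num), frontier_Ioo (by norm_num)] at hq
    simp only [Set.mem_union, Set.mem_prod, Set.mem_Icc, Set.mem_insert_iff,
      Set.mem_singleton_iff] at hq
    have b₁ (s : ℝ) (hs : -1 ≤ s ∧ s ≤ 1) : v (s, 0) ≤ a₁ := h₁ _ ⟨hs, rfl⟩
    have b₂ (s : ℝ) (hs : 0 ≤ s ∧ s ≤ 2) : v (1, s) ≤ a₂ := h₂ _ ⟨rfl, hs⟩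
    have b₃ (s : ℝ) (hs : -1 ≤ s ∧ s ≤ 1) : v (s, 2) ≤ a₃ := h₃ _ ⟨hs, rfl⟩
    have b₄ (s : ℝ) (hs : 0 ≤ s ∧ s ≤ 2) : v (-1, s) ≤ a₄ := h₄ _ ⟨rfl, hs⟩
    rcases hq with ⟨⟨_, _⟩, rfl | rfl⟩ | ⟨rfl | rfl, _, _⟩
    · have c₁ := b₁ x (by constructor <;> linarith)
      have c₂ := b₂ (1 + x) (by constructor <;> linarith)
      have c₃ := b₃ (-x) (by constructor <;> linarith)
      have c₄ := b₄ (1 - x) (by constructor <;> linarith)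
      ring_nf at c₁ c₂ c₃ c₄ ⊢
      linarith
    · have c₁ := b₁ (-x) (by constructor <;> linarith)
      have c₂ := b₂ (1 - x) (by constructor <;> linarith)
      have c₃ := b₃ x (by constructor <;> linarith)
      have c₄ := b₄ (1 + x) (by constructor <;> linarith)
      ring_nf at c₁ c₂ c₃ c₄ ⊢
      linarith
    · have c₁ := b₁ (1 - y) (by constructor <;> linarith)
      have c₂ := b₂ (2 - y) (by constructor <;> linarith)
      have c₃ := b₃ (y - 1) (by constructor <;> linarith)
      have c₄ := b₄ y (by constructor <;> linarith)
      ring_nf at c₁ c₂ c₃ c₄ ⊢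
      linarith
    · have c₁ := b₁ (y - 1) (by constructor <;> linarith)
      have c₂ := b₂ y (by constructor <;> linarith)
      have c₃ := b₃ (1 - y) (by constructor <;> linarith)
      have c₄ := b₄ (2 - y) (by constructor <;> linarith)
      ring_nf at c₁ c₂ c₃ c₄ ⊢
      linarith
end

section
/- Assume that for every N > 0 there exists a constant C_N > 0 such that |u(x,1)| ≤ C_N·exp(−N x²) for all x > 0. Then f is identically zero, and consequently u vanishes identically on ℍ. -/
open MeasureTheory Real

/-- `F` decays faster than every Gaussian along the ray `{a r | 0 ≤ r}`. -/
def SuperGaussianDecayOnRay (F : ℂ → ℂ) (a : ℂ) : Prop :=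
  ∀ N : ℝ, ∃ C : ℝ, ∀ r : ℝ, 0 ≤ r → ‖F (a * r)‖ ≤ C * Real.exp (-N * r ^ 2)

theorem norm_cpow_two_inv_sq (w : ℂ) : ‖w ^ (2⁻¹ : ℂ)‖ ^ 2 = ‖w‖ := by
  rw [← norm_pow, Complex.cpow_ofNat_inv_pow]

theorem ofReal_cpow_two_inv {x : ℝ} (hx : 0 ≤ x) : (x : ℂ) ^ (2⁻¹ : ℂ) = (√x : ℝ) := by
  rw [Real.sqrt_eq_rpow, Complex.ofReal_cpow hx]
  norm_num

theorem diffContOnCl_comp_mul_cpow_two_inv {F : ℂ → ℂ} (hF : Differentiable ℂ F) (a : ℂ) :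
    DiffContOnCl ℂ (fun w ↦ F (a * w ^ (2⁻¹ : ℂ))) {w | 0 < w.re} := by
  constructor
  · intro w hw
    have h : DifferentiableAt ℂ (fun w : ℂ ↦ a * w ^ (2⁻¹ : ℂ)) w :=
      (differentiableAt_id.cpow_const (Or.inl hw)).const_mul a
    exact (hF.differentiableAt.comp w h).differentiableWithinAt
  · rw [Complex.closure_setOfPred_lt_re]
    intro w hw
    have h : ContinuousAt (fun w : ℂ ↦ w ^ (2⁻¹ : ℂ)) w :=
      Complex.continuousAt_cpow_const_of_re_pos (Or.inl hw) (by norm_num)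
    exact (hF.continuous.continuousAt.comp (h.const_mul a)).continuousWithinAt

theorem norm_comp_mul_cpow_two_inv_le {F : ℂ → ℂ} {A B : ℝ}
    (hFB : ∀ z, ‖F z‖ ≤ A * Real.exp (B * ‖z‖ ^ 2)) {a : ℂ} (ha : ‖a‖ = 1) (w : ℂ) :
    ‖F (a * w ^ (2⁻¹ : ℂ))‖ ≤ A * Real.exp (B * ‖w‖) := by
  simpa [mul_pow, ha, norm_cpow_two_inv_sq] using hFB (a * w ^ (2⁻¹ : ℂ))

/-- Super-Gaussian decay of an entire function of order two and finite type propagates from a ray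
to the ray at angle `π / 8` from it. -/
theorem SuperGaussianDecayOnRay.rotate {F : ℂ → ℂ} (hF : Differentiable ℂ F) {A B : ℝ}
    (hB0 : 0 ≤ B) (hFB : ∀ z, ‖F z‖ ≤ A * Real.exp (B * ‖z‖ ^ 2)) {a : ℂ} (ha : ‖a‖ = 1)
    (h : SuperGaussianDecayOnRay F a) :
    SuperGaussianDecayOnRay F (a * Complex.exp ((π / 8 : ℝ) * Complex.I)) := by
  intro N
  have hA : 0 ≤ A := by simpa using (norm_nonneg _).trans (hFB 0)
  obtain ⟨C, hC⟩ := h (B + √2 * N)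
  set N' := B + √2 * N with hN'
  set ζ := Complex.exp ((π / 8 : ℝ) * Complex.I) with hζ
  set K : ℂ → ℂ := fun w ↦
    F (a * w ^ (2⁻¹ : ℂ)) * Complex.exp ((N' + B * Complex.I) * w) with hK
  have hKnorm (w : ℂ) : ‖K w‖ =
      ‖F (a * w ^ (2⁻¹ : ℂ))‖ * Real.exp (N' * w.re - B * w.im) := by
    simp [hK, Complex.norm_exp]
  have hsub : (Set.Ioi 0 ×ℂ Set.Ioi 0) ⊆ {w : ℂ | 0 < w.re} := fun w hw ↦ hw.1
  have hKd : DiffContOnCl ℂ K (Set.Ioi 0 ×ℂ Set.Ioi 0) := by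
    have h1 := (diffContOnCl_comp_mul_cpow_two_inv hF a).mono hsub
    have h2 : Differentiable ℂ fun w : ℂ ↦ Complex.exp ((N' + B * Complex.I) * w) := by fun_prop
    exact h1.smul h2.diffContOnCl
  have hKO : ∃ c < (2 : ℝ), ∃ B', K =O[Bornology.cobounded ℂ ⊓
      Filter.principal (Set.Ioi 0 ×ℂ Set.Ioi 0)] fun z ↦ Real.exp (B' * ‖z‖ ^ c) := by
    refine ⟨1, by norm_num, B + (|N'| + B), Asymptotics.IsBigO.of_bound A <|
      Filter.Eventually.of_forall fun w ↦ ?_⟩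
    rw [hKnorm, Real.norm_eq_abs, Real.abs_exp, Real.rpow_one,
      add_mul B (|N'| + B), Real.exp_add, ← mul_assoc]
    gcongr
    · exact norm_comp_mul_cpow_two_inv_le hFB ha w
    · have h1 : N' * w.re ≤ |N'| * ‖w‖ := (le_abs_self _).trans <| by
        rw [abs_mul]; gcongr; exact Complex.abs_re_le_norm w
      have h2 : -(B * w.im) ≤ B * ‖w‖ := by
        rw [← mul_neg]; gcongr; exact (neg_le_abs _).trans (Complex.abs_im_le_norm w)
      linarith
  have hre (x : ℝ) (hx : 0 ≤ x) : ‖K x‖ ≤ max C A := by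
    refine le_max_of_le_left ?_
    have := hC (√x) (Real.sqrt_nonneg x)
    rw [Real.sq_sqrt hx, neg_mul, Real.exp_neg, ← div_eq_mul_inv,
      le_div_iff₀ (Real.exp_pos _)] at this
    rw [hKnorm, ofReal_cpow_two_inv hx]
    simpa using this
  have him (x : ℝ) (hx : 0 ≤ x) : ‖K (x * Complex.I)‖ ≤ max C A := by
    refine le_max_of_le_right ?_
    have := norm_comp_mul_cpow_two_inv_le hFB ha (x * Complex.I)
    rw [hKnorm]
    simp only [norm_mul, Complex.norm_real, Complex.norm_I, Real.norm_eq_abs, abs_of_nonneg hx,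
      mul_one] at this
    simp [Real.exp_neg]
    rwa [← div_eq_mul_inv, div_le_iff₀ (Real.exp_pos _)]
  refine ⟨max C A, fun r hr ↦ ?_⟩
  have hsq : (r * ζ) ^ 2 = (r ^ 2 : ℝ) * Complex.exp ((π / 4 : ℝ) * Complex.I) := by
    rw [mul_pow, hζ, ← Complex.exp_nat_mul]
    push_cast
    ring_nf
  have hwre : ((r * ζ) ^ 2).re = r ^ 2 * (√2 / 2) := by
    rw [hsq, Complex.re_ofReal_mul, Complex.exp_ofReal_mul_I_re, cos_pi_div_four]
  have hwim : ((r * ζ) ^ 2).im = r ^ 2 * (√2 / 2) := by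
    rw [hsq, Complex.im_ofReal_mul, Complex.exp_ofReal_mul_I_im, sin_pi_div_four]
  have hroot : ((r * ζ) ^ 2) ^ (2⁻¹ : ℂ) = r * ζ := by
    rcases hr.eq_or_lt with rfl | hr
    · simp
    · refine Complex.sq_cpow_two_inv ?_
      rw [Complex.re_ofReal_mul, Complex.exp_ofReal_mul_I_re]
      exact mul_pos hr (cos_pos_of_mem_Ioo ⟨by linarith [pi_pos], by linarith [pi_pos]⟩)
  have key := PhragmenLindelof.quadrant_I hKd hKO hre him
    (z := (r * ζ) ^ 2) (by rw [hwre]; positivity) (by rw [hwim]; positivity)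
  rw [hKnorm, hroot, hwre, hwim] at key
  have h2 : √2 * √2 = 2 := Real.mul_self_sqrt (by norm_num)
  have hexp : N' * (r ^ 2 * (√2 / 2)) - B * (r ^ 2 * (√2 / 2)) = N * r ^ 2 := by
    rw [hN']; linear_combination (N * r ^ 2 / 2) * h2
  rw [hexp] at key
  rw [neg_mul, Real.exp_neg, ← div_eq_mul_inv, le_div_iff₀ (Real.exp_pos _)]
  rwa [mul_assoc a, mul_comm ζ]

/-- An entire function of order two and finite type that decays faster than every Gaussian along
the positive real axis vanishes. -/
theorem eq_zero_of_superGaussianDecayOnRay {F : ℂ → ℂ} (hF : Differentiable ℂ F) {A B : ℝ}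
    (hB0 : 0 ≤ B) (hFB : ∀ z, ‖F z‖ ≤ A * Real.exp (B * ‖z‖ ^ 2))
    (h : SuperGaussianDecayOnRay F 1) (z : ℂ) : F z = 0 := by
  set ζ := Complex.exp ((π / 8 : ℝ) * Complex.I) with hζ
  set η := Complex.exp ((π / 4 : ℝ) * Complex.I) with hη
  have hζζ : ζ * ζ = η := by
    rw [hζ, hη, ← Complex.exp_add]; push_cast; ring_nf
  have hηη : η * η = Complex.I := by
    rw [hη, ← Complex.exp_add]
    convert Complex.exp_pi_div_two_mul_I using 2
    push_cast; ring
  have hnζ : ‖ζ‖ = 1 := Complex.norm_exp_ofReal_mul_I _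
  have hnη : ‖η‖ = 1 := Complex.norm_exp_ofReal_mul_I _
  have hrot {a : ℂ} (ha : ‖a‖ = 1) (h : SuperGaussianDecayOnRay F a) :
      SuperGaussianDecayOnRay F (a * η) := by
    have := (h.rotate hF hB0 hFB ha).rotate hF hB0 hFB (by rw [norm_mul, ha, hnζ, one_mul])
    rwa [mul_assoc, ← hζ, hζζ] at this
  have hdη : SuperGaussianDecayOnRay F η := by simpa using hrot norm_one h
  have hdI : SuperGaussianDecayOnRay F Complex.I := by simpa [hηη] using hrot hnη hdη
  have hηre : 0 < η.re := by
    rw [Complex.exp_ofReal_mul_I_re, cos_pi_div_four]; positivity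
  have hconj : η * (starRingEnd ℂ) η = 1 := by simp [Complex.mul_conj', hnη]
  have hconj2 : (starRingEnd ℂ) η * (starRingEnd ℂ) η = -Complex.I := by
    rw [← map_mul, hηη, Complex.conj_I]
  have hroot {b : ℂ} (hb : 0 < b.re) {r : ℝ} (hr : 0 ≤ r) :
      (r * (b * b)) ^ (2⁻¹ : ℂ) = √r * b := by
    have : (r * (b * b) : ℂ) = (√r * b) ^ 2 := by
      rw [mul_pow, ← Complex.ofReal_pow, Real.sq_sqrt hr, sq]
    rw [this]
    rcases hr.eq_or_lt with rfl | hr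
    · simp
    · refine Complex.sq_cpow_two_inv ?_
      rw [Complex.re_ofReal_mul]
      exact mul_pos (Real.sqrt_pos.2 hr) hb
  have hG : Set.EqOn (fun w : ℂ ↦ F (η * w ^ (2⁻¹ : ℂ))) 0 {w | 0 ≤ w.re} := by
    refine PhragmenLindelof.eq_zero_on_right_half_plane_of_superexponential_decay
      (diffContOnCl_comp_mul_cpow_two_inv hF η) ?_ ?_ ?_
    · refine ⟨1, by norm_num, B, Asymptotics.IsBigO.of_bound A <|
        Filter.Eventually.of_forall fun w ↦ ?_⟩
      simpa using norm_comp_mul_cpow_two_inv_le hFB hnη w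
    · intro n
      obtain ⟨C, hC⟩ := hdη (n + 1)
      have hlim : Filter.Tendsto (fun x : ℝ ↦ C * Real.exp (-x)) Filter.atTop (nhds 0) := by
        simpa using (Real.tendsto_exp_neg_atTop_nhds_zero).const_mul C
      refine squeeze_zero' (Filter.Eventually.of_forall fun x ↦ by positivity) ?_ hlim
      filter_upwards [Filter.eventually_ge_atTop 0] with x hx
      rw [ofReal_cpow_two_inv hx]
      have := hC _ (Real.sqrt_nonneg x)
      rw [Real.sq_sqrt hx] at this
      calc _ ≤ Real.exp x ^ n * (C * Real.exp (-(n + 1) * x)) := by gcongr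
        _ = C * (Real.exp (n * x) * Real.exp (-(n + 1) * x)) := by
          rw [Real.exp_nat_mul]; ring
        _ = C * Real.exp (-x) := by rw [← Real.exp_add]; ring_nf
    · obtain ⟨C, hC⟩ := hdI 0
      obtain ⟨C', hC'⟩ := h 0
      refine ⟨max C C', fun x ↦ ?_⟩
      rcases le_total 0 x with hx | hx
      · refine le_max_of_le_left ?_
        have := hC _ (Real.sqrt_nonneg x)
        rw [← hηη, hroot hηre hx]
        rw [← hηη] at this
        simpa [mul_assoc, mul_comm, mul_left_comm] using this
      · refine le_max_of_le_right ?_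
        have := hC' _ (Real.sqrt_nonneg (-x))
        have e : (x : ℂ) * Complex.I =
            ((-x : ℝ) : ℂ) * ((starRingEnd ℂ) η * (starRingEnd ℂ) η) := by
          rw [hconj2]; push_cast; ring
        rw [e, hroot (by simpa using hηre) (neg_nonneg.2 hx), mul_left_comm, hconj]
        simpa using this
  have hη0 : η ≠ 0 := Complex.exp_ne_zero _
  have hHa : AnalyticOnNhd ℂ (fun v ↦ F (η * v)) Set.univ := fun v _ ↦
    (hF.comp (differentiable_id.const_mul η)).analyticAt v
  have hev : (fun v ↦ F (η * v)) =ᶠ[nhds 1] 0 := by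
    have h1 : ∀ᶠ v : ℂ in nhds 1, 0 < v.re :=
      Complex.continuous_re.continuousAt.eventually (lt_mem_nhds (by simp))
    have h2 : ∀ᶠ v : ℂ in nhds 1, 0 < (v ^ 2).re :=
      (Complex.continuous_re.comp (continuous_pow 2)).continuousAt.eventually
        (lt_mem_nhds (by simp))
    filter_upwards [h1, h2] with v hv hv2
    simpa [Complex.sq_cpow_two_inv hv] using hG hv2.le
  have := congrFun (hHa.eq_of_eventuallyEq (g := 0) (fun w _ ↦ analyticAt_const) hev) (z / η)
  simpa [mul_div_cancel₀ _ hη0] using this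

/-- The two-sided Laplace transform of `f` times the Gaussian `exp (-y ^ 2 / 4)`. -/
noncomputable def gaussianLaplace (f : ℝ → ℝ) (z : ℂ) : ℂ :=
  ∫ y : ℝ, Complex.exp (z * y - y ^ 2 / 4) * f y

theorem norm_cexp_mul_sub_sq_le {z : ℂ} {R : ℝ} (hz : ‖z‖ ≤ R) (y : ℝ) :
    ‖Complex.exp (z * y - y ^ 2 / 4)‖ ≤
      Real.exp (2 * R ^ 2) * Real.exp (-(1 / 8) * y ^ 2) := by
  have hre : (z * y - y ^ 2 / 4 : ℂ).re = z.re * y - y ^ 2 / 4 := by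
    have : (y ^ 2 / 4 : ℂ) = ((y ^ 2 / 4 : ℝ) : ℂ) := by push_cast; rfl
    rw [this, Complex.sub_re, Complex.ofReal_re, Complex.re_mul_ofReal]
  rw [Complex.norm_exp, hre, ← Real.exp_add, Real.exp_le_exp]
  have h : z.re ^ 2 ≤ R ^ 2 := sq_le_sq' (by linarith [neg_abs_le z.re, Complex.abs_re_le_norm z])
    ((le_abs_self _).trans ((Complex.abs_re_le_norm z).trans hz))
  nlinarith [sq_nonneg (y - 4 * z.re)]

theorem integrable_cexp_mul_sub_sq_mul {f : ℝ → ℝ} (hf : Continuous f) {M : ℝ}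
    (hM : ∀ x, |f x| ≤ M) (z : ℂ) :
    Integrable fun y : ℝ ↦ Complex.exp (z * y - y ^ 2 / 4) * f y := by
  have hb : Integrable fun y : ℝ ↦
      Real.exp (2 * ‖z‖ ^ 2) * Real.exp (-(1 / 8) * y ^ 2) * M :=
    ((integrable_exp_neg_mul_sq (by norm_num)).const_mul _).mul_const M
  refine hb.mono' (by fun_prop) (Filter.Eventually.of_forall fun y ↦ ?_)
  rw [norm_mul, Complex.norm_real, Real.norm_eq_abs]
  exact mul_le_mul (norm_cexp_mul_sub_sq_le le_rfl y) (hM y) (abs_nonneg _) (by positivity)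

theorem differentiable_gaussianLaplace {f : ℝ → ℝ} (hf : Continuous f) {M : ℝ}
    (hM : ∀ x, |f x| ≤ M) : Differentiable ℂ (gaussianLaplace f) := by
  intro z
  have hb : Integrable fun y : ℝ ↦
      Real.exp (2 * (‖z‖ + 2) ^ 2) * Real.exp (-(1 / 8) * y ^ 2) * M +
      Real.exp (2 * (‖z‖ + 2) ^ 2) * Real.exp (-(1 / 8) * y ^ 2) * M := by
    have := ((integrable_exp_neg_mul_sq (b := 1 / 8) (by norm_num)).const_mul
      (Real.exp (2 * (‖z‖ + 2) ^ 2))).mul_const M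
    exact this.add this
  refine (hasDerivAt_integral_of_dominated_loc_of_deriv_le
    (F := fun (w : ℂ) (y : ℝ) ↦ Complex.exp (w * y - y ^ 2 / 4) * f y)
    (F' := fun (w : ℂ) (y : ℝ) ↦ Complex.exp (w * y - y ^ 2 / 4) * y * f y)
    (Metric.ball_mem_nhds z one_pos)
    (Filter.Eventually.of_forall fun w ↦ (integrable_cexp_mul_sub_sq_mul hf hM w).1)
    (integrable_cexp_mul_sub_sq_mul hf hM z)
    (Continuous.aestronglyMeasurable (by fun_prop)) ?_ hb ?_).2.differentiableAt
  · refine Filter.Eventually.of_forall fun y w hw ↦ ?_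
    have hw' : ‖w‖ ≤ ‖z‖ + 1 := by
      rw [mem_ball_iff_norm] at hw
      linarith [norm_le_norm_add_norm_sub' w z]
    have hsplit : ‖Complex.exp (w * y - y ^ 2 / 4)‖ * |y| ≤
        ‖Complex.exp ((w + 1) * y - y ^ 2 / 4)‖ + ‖Complex.exp ((w - 1) * y - y ^ 2 / 4)‖ := by
      have h1 : (w + 1) * y - y ^ 2 / 4 = (w * y - y ^ 2 / 4) + (y : ℂ) := by ring
      have h2 : (w - 1) * y - y ^ 2 / 4 = (w * y - y ^ 2 / 4) + ((-y : ℝ) : ℂ) := by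
        push_cast; ring
      rw [h1, h2, Complex.exp_add, Complex.exp_add, norm_mul, norm_mul, ← mul_add,
        Complex.norm_exp_ofReal, Complex.norm_exp_ofReal]
      gcongr
      rcases abs_cases y with ⟨h, _⟩ | ⟨h, _⟩ <;> rw [h]
      · linarith [Real.add_one_le_exp y, Real.exp_pos (-y)]
      · linarith [Real.add_one_le_exp (-y), Real.exp_pos y]
    have hp : ‖w + 1‖ ≤ ‖z‖ + 2 := (norm_add_le _ _).trans (by rw [norm_one]; linarith)
    have hm : ‖w - 1‖ ≤ ‖z‖ + 2 := (norm_sub_le _ _).trans (by rw [norm_one]; linarith)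
    rw [norm_mul, norm_mul, Complex.norm_real, Complex.norm_real, Real.norm_eq_abs,
      Real.norm_eq_abs, ← add_mul]
    exact mul_le_mul (hsplit.trans (add_le_add (norm_cexp_mul_sub_sq_le hp y)
      (norm_cexp_mul_sub_sq_le hm y))) (hM y) (abs_nonneg _) (by positivity)
  · refine Filter.Eventually.of_forall fun y w _ ↦ HasDerivAt.mul_const ?_ _
    simpa using (((hasDerivAt_id w).mul_const (y : ℂ)).sub_const ((y : ℂ) ^ 2 / 4)).cexp

theorem norm_gaussianLaplace_le {f : ℝ → ℝ} {M : ℝ} (hM : ∀ x, |f x| ≤ M) (z : ℂ) :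
    ‖gaussianLaplace f z‖ ≤
      (∫ y : ℝ, Real.exp (-(1 / 8) * y ^ 2) * M) * Real.exp (2 * ‖z‖ ^ 2) := by
  rw [mul_comm, ← integral_const_mul]
  refine norm_integral_le_of_norm_le
    (((integrable_exp_neg_mul_sq (by norm_num)).mul_const M).const_mul _)
    (Filter.Eventually.of_forall fun y ↦ ?_)
  rw [norm_mul, Complex.norm_real, Real.norm_eq_abs, ← mul_assoc]
  exact mul_le_mul (norm_cexp_mul_sub_sq_le le_rfl y) (hM y) (abs_nonneg _) (by positivity)

/-- A bounded continuous function whose Gaussian Laplace transform vanishes is zero. -/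
theorem eq_zero_of_gaussianLaplace_eq_zero {f : ℝ → ℝ} (hf : Continuous f) {M : ℝ}
    (hM : ∀ x, |f x| ≤ M) (h : ∀ z, gaussianLaplace f z = 0) (x : ℝ) : f x = 0 := by
  set g : ℝ → ℂ := fun y ↦ Complex.exp (0 * y - y ^ 2 / 4) * f y with hg
  have hgi : Integrable g := integrable_cexp_mul_sub_sq_mul hf hM 0
  have hgF : FourierTransform.fourier g = 0 := by
    ext w
    rw [Real.fourier_real_eq_integral_exp_smul, Pi.zero_apply, ← h (-2 * π * w * Complex.I),
      gaussianLaplace]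
    refine integral_congr_ae (Filter.Eventually.of_forall fun y ↦ ?_)
    simp only [hg, smul_eq_mul, ← mul_assoc, ← Complex.exp_add]
    congr 2
    push_cast; ring
  have hgx := hgi.fourierInv_fourier_eq (v := x) (by rw [hgF]; exact integrable_zero _ _ _)
    (Continuous.continuousAt (by fun_prop))
  rw [hgF, Real.fourierInv_eq] at hgx
  have : g x = 0 := by simpa using hgx.symm
  simpa [hg, Complex.exp_ne_zero] using this

/-- The Gaussian convolution of `f` expressed through its Gaussian Laplace transform. -/
theorem gaussianLaplace_ofReal (f : ℝ → ℝ) (r : ℝ) :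
    gaussianLaplace f r = (Real.exp (r ^ 2) *
      ∫ y : ℝ, Real.exp (-((2 * r - y) ^ 2) / 4) * f y : ℝ) := by
  rw [gaussianLaplace, ← integral_const_mul, ← integral_complex_ofReal]
  refine integral_congr_ae (Filter.Eventually.of_forall fun y ↦ ?_)
  simp only [← mul_assoc, ← Real.exp_add, Complex.ofReal_mul, Complex.ofReal_exp]
  congr 2
  push_cast; ring

/-- **Lemma 5.** If the bounded solution of the heat equation given by the Poisson
formula decays faster than every Gaussian along the line `{t = 1}`, `x > 0`, then
`f ≡ 0` and hence `u ≡ 0` on the half-plane. -/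
theorem heat_gaussian_decay_eq_zero
    (f : ℝ → ℝ) (hf_cont : Continuous f) (M : ℝ) (hf_bdd : ∀ x, |f x| ≤ M)
    (u : ℝ → ℝ → ℝ)
    (hu : ∀ x t, 0 < t →
      u x t = (Real.sqrt (4 * Real.pi * t))⁻¹ *
        ∫ y : ℝ, Real.exp (-((x - y) ^ 2) / (4 * t)) * f y)
    (hu0 : ∀ x, u x 0 = f x)
    (hdecay : ∀ N : ℝ, 0 < N → ∃ C_N : ℝ, 0 < C_N ∧
      ∀ x : ℝ, 0 < x → |u x 1| ≤ C_N * Real.exp (-N * x ^ 2)) :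
    (∀ x : ℝ, f x = 0) ∧ ∀ x t : ℝ, 0 ≤ t → u x t = 0 := by
  have hf : ∀ x, f x = 0 := by
    refine eq_zero_of_gaussianLaplace_eq_zero hf_cont hf_bdd <|
      eq_zero_of_superGaussianDecayOnRay (differentiable_gaussianLaplace hf_cont hf_bdd)
        zero_le_two (norm_gaussianLaplace_le hf_bdd) fun N ↦ ?_
    obtain ⟨C, hC0, hC⟩ := hdecay (|N| + 1) (by positivity)
    refine ⟨max (√(4 * π) * C) ‖gaussianLaplace f 0‖, fun r hr ↦ ?_⟩
    rcases hr.eq_or_lt with rfl | hr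
    · simp
    have hint : ∫ y : ℝ, Real.exp (-((2 * r - y) ^ 2) / 4) * f y = √(4 * π) * u (2 * r) 1 := by
      rw [hu _ _ one_pos, mul_one, mul_one, mul_inv_cancel_left₀ (by positivity)]
    rw [one_mul, gaussianLaplace_ofReal, hint, Complex.norm_real, Real.norm_eq_abs, abs_mul,
      abs_mul, Real.abs_exp, abs_of_nonneg (Real.sqrt_nonneg _)]
    calc Real.exp (r ^ 2) * (√(4 * π) * |u (2 * r) 1|)
        ≤ Real.exp (r ^ 2) * (√(4 * π) * (C * Real.exp (-(|N| + 1) * (2 * r) ^ 2))) := by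
          gcongr; exact hC _ (by positivity)
      _ = √(4 * π) * C * Real.exp (r ^ 2 + -(|N| + 1) * (2 * r) ^ 2) := by
          rw [Real.exp_add]; ring
      _ ≤ _ := by
          gcongr
          · exact le_max_left _ _
          · nlinarith [mul_nonneg (abs_nonneg N) (sq_nonneg r), sq_nonneg r,
              mul_le_mul_of_nonneg_right (le_abs_self N) (sq_nonneg r)]
  refine ⟨hf, fun x t ht ↦ ?_⟩
  rcases ht.eq_or_lt with rfl | ht
  · rw [hu0, hf]
  · simp [hu x t ht, hf]
end

section
/- Suppose there exist t₀ > 0 and real numbers c < d such that u(x, t₀) = 0 for every x ∈ [c,d] (u vanishes on a horizontal segment at a positive time). Then f is identically zero on ℝ. -/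
open MeasureTheory Real

open scoped Topology NNReal ENNReal

section

open ProbabilityTheory

/-- Two finite measures on `ℝ` with all exponential moments whose moment generating functions
agree on a set accumulating at some point are equal. -/
theorem measure_eq_of_frequently_mgf_eq {μ ν : Measure ℝ} [IsFiniteMeasure μ] [IsFiniteMeasure ν]
    (hμ : integrableExpSet id μ = Set.univ) (hν : integrableExpSet id ν = Set.univ) {s₀ : ℝ}
    (h : ∃ᶠ s in 𝓝[≠] s₀, mgf id μ s = mgf id ν s) : μ = ν := by
  have analytic {ρ : Measure ℝ} (hρ : integrableExpSet id ρ = Set.univ) :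
      AnalyticOnNhd ℝ (mgf id ρ) Set.univ := by
    simpa [hρ] using analyticOnNhd_mgf (X := id) (μ := ρ)
  have hmgf : mgf id μ = mgf id ν := (analytic hμ).eq_of_frequently_eq (analytic hν) h
  have hzero : μ = 0 ↔ ν = 0 := by
    have h0 := congrFun hmgf 0
    simp only [mgf_zero'] at h0
    rw [← Measure.measure_univ_eq_zero, ← measureReal_eq_zero_iff, h0, measureReal_eq_zero_iff,
      Measure.measure_univ_eq_zero]
  refine Measure.ext_of_complexMGF_id_eq (funext fun z ↦ ?_)
  exact eqOn_complexMGF_of_mgf' hmgf hzero (by simp [hμ])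

/-- A bounded function orthogonal to the exponentials `y ↦ exp (s * y)`, for `s` in a set with
an accumulation point, vanishes almost everywhere. -/
theorem ae_eq_zero_of_frequently_integral_exp_mul_eq_zero {γ : Measure ℝ} [IsFiniteMeasure γ]
    (hγ : integrableExpSet id γ = Set.univ) {f : ℝ → ℝ} (hf : Measurable f) {M : ℝ}
    (hM : ∀ x, |f x| ≤ M) {s₀ : ℝ}
    (h : ∃ᶠ s in 𝓝[≠] s₀, ∫ y, exp (s * y) * f y ∂γ = 0) : f =ᵐ[γ] 0 := by
  have hexp (s : ℝ) : Integrable (fun y ↦ exp (s * y)) γ := by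
    have : s ∈ integrableExpSet id γ := hγ ▸ Set.mem_univ s
    exact this
  have hM0 : 0 ≤ M := (abs_nonneg _).trans (hM 0)
  have key (g : ℝ → ℝ≥0) (hg : Measurable g) (hb : ∀ x, (g x : ℝ) ≤ 2 * M) :
      integrableExpSet id (γ.withDensity fun x ↦ (g x : ℝ≥0∞)) = Set.univ := by
    refine Set.eq_univ_of_forall fun s ↦ ?_
    change Integrable (fun y ↦ exp (s * y)) _
    rw [integrable_withDensity_iff_integrable_coe_smul hg]
    refine (hexp s).bdd_mul (c := 2 * M) (by fun_prop) (.of_forall fun x ↦ ?_)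
    simpa using hb x
  have fin (g : ℝ → ℝ≥0) (hg : Measurable g) (hb : ∀ x, (g x : ℝ) ≤ 2 * M) :
      IsFiniteMeasure (γ.withDensity fun x ↦ (g x : ℝ≥0∞)) := by
    have h0 : (0 : ℝ) ∈ integrableExpSet id (γ.withDensity fun x ↦ (g x : ℝ≥0∞)) :=
      key g hg hb ▸ Set.mem_univ _
    have h1 : Integrable (fun _ : ℝ ↦ (1 : ℝ)) (γ.withDensity fun x ↦ (g x : ℝ≥0∞)) := by
      simpa [integrableExpSet] using h0
    exact (integrable_const_iff_isFiniteMeasure one_ne_zero).1 h1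
  let g₁ : ℝ → ℝ≥0 := fun x ↦ (f x + M).toNNReal
  let g₂ : ℝ → ℝ≥0 := fun _ ↦ M.toNNReal
  have hg₁ : Measurable g₁ := (hf.add_const M).real_toNNReal
  have hg₂ : Measurable g₂ := measurable_const
  have hc₁ (x : ℝ) : (g₁ x : ℝ) = f x + M :=
    Real.coe_toNNReal _ (by linarith [neg_le_of_abs_le (hM x)])
  have hc₂ (x : ℝ) : (g₂ x : ℝ) = M := Real.coe_toNNReal _ hM0
  have hb₁ (x : ℝ) : (g₁ x : ℝ) ≤ 2 * M := by
    rw [hc₁ x]; linarith [le_of_abs_le (hM x)]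
  have hb₂ (x : ℝ) : (g₂ x : ℝ) ≤ 2 * M := by
    rw [hc₂ x]; linarith
  have := fin g₁ hg₁ hb₁
  have := fin g₂ hg₂ hb₂
  have heq : (γ.withDensity fun x ↦ (g₁ x : ℝ≥0∞)) = γ.withDensity fun x ↦ (g₂ x : ℝ≥0∞) := by
    refine measure_eq_of_frequently_mgf_eq (key g₁ hg₁ hb₁) (key g₂ hg₂ hb₂)
      (h.mono fun s hs ↦ ?_)
    have hint : Integrable (fun y ↦ exp (s * y) * f y) γ :=
      (hexp s).mul_bdd (c := M) hf.aestronglyMeasurable (.of_forall hM)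
    simp only [mgf, id]
    rw [integral_withDensity_eq_integral_smul hg₁, integral_withDensity_eq_integral_smul hg₂]
    simp only [NNReal.smul_def, hc₁, hc₂, smul_eq_mul]
    have hsplit (y : ℝ) :
        (f y + M) * exp (s * y) = exp (s * y) * f y + M * exp (s * y) := by ring
    simp only [hsplit]
    rw [integral_add hint ((hexp s).const_mul M), hs, zero_add]
  rw [withDensity_eq_iff_of_sigmaFinite (by fun_prop) (by fun_prop)] at heq
  filter_upwards [heq] with x hx
  have hx' : (g₁ x : ℝ) = g₂ x := by exact_mod_cast hx
  rw [hc₁ x, hc₂ x] at hx'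
  simpa using hx'

/-- The heat kernel integral as an exponential moment of a Gaussian measure. -/
theorem inv_sqrt_mul_integral_heat_kernel (f : ℝ → ℝ) (x : ℝ) {t : ℝ} (ht : 0 < t) :
    (√(4 * π * t))⁻¹ * ∫ y : ℝ, exp (-((x - y) ^ 2) / (4 * t)) * f y =
      exp (-(x ^ 2) / (4 * t)) *
        ∫ y, exp (x / (2 * t) * y) * f y ∂gaussianReal 0 (2 * t).toNNReal := by
  have hv : (2 * t).toNNReal ≠ 0 := by simpa using ht
  rw [integral_gaussianReal_eq_integral_smul hv, ← integral_const_mul, ← integral_const_mul]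
  congr 1 with y
  have hexp : exp (-((x - y) ^ 2) / (4 * t)) =
      exp (-(x ^ 2) / (4 * t)) * (exp (-(y ^ 2) / (4 * t)) * exp (x / (2 * t) * y)) := by
    rw [← exp_add, ← exp_add]
    congr 1
    field_simp
    ring
  rw [gaussianPDFReal, Real.coe_toNNReal _ (by positivity), sub_zero, smul_eq_mul, hexp,
    show 2 * π * (2 * t) = 4 * π * t by ring, show 2 * (2 * t) = 4 * t by ring]
  ring

end

/-- If the bounded solution of the heat equation given by the Poisson formula
vanishes on a horizontal segment `[c,d] × {t₀}` at a positive time `t₀`, then the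
initial data `f` vanishes identically. -/
theorem heat_vanish_on_horizontal_segment
    (f : ℝ → ℝ) (hf_cont : Continuous f) (M : ℝ) (hf_bdd : ∀ x, |f x| ≤ M)
    (u : ℝ → ℝ → ℝ)
    (hu : ∀ x t, 0 < t →
      u x t = (Real.sqrt (4 * Real.pi * t))⁻¹ *
        ∫ y : ℝ, Real.exp (-((x - y) ^ 2) / (4 * t)) * f y)
    (hu0 : ∀ x, u x 0 = f x)
    (t₀ : ℝ) (ht₀ : 0 < t₀) (c d : ℝ) (hcd : c < d)
    (hvanish : ∀ x ∈ Set.Icc c d, u x t₀ = 0) :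
    ∀ x : ℝ, f x = 0 := by
  have hv : (2 * t₀).toNNReal ≠ 0 := by simpa using ht₀
  have hγ : ProbabilityTheory.integrableExpSet id
      (ProbabilityTheory.gaussianReal 0 (2 * t₀).toNNReal) = Set.univ :=
    ProbabilityTheory.integrableExpSet_id_gaussianReal
  have hmoment : ∀ᶠ s in 𝓝 ((c + d) / 2 / (2 * t₀)),
      ∫ y, exp (s * y) * f y ∂ProbabilityTheory.gaussianReal 0 (2 * t₀).toNNReal = 0 := by
    have hmem : ∀ᶠ s in 𝓝 ((c + d) / 2 / (2 * t₀)), s * (2 * t₀) ∈ Set.Icc c d := by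
      refine (continuous_mul_const (2 * t₀)).continuousAt.eventually_mem
        (Icc_mem_nhds ?_ ?_)
      all_goals
        rw [div_mul_cancel₀ _ (by positivity)]
        linarith
    filter_upwards [hmem] with s hs
    have h0 := hvanish _ hs
    rw [hu _ _ ht₀, inv_sqrt_mul_integral_heat_kernel f _ ht₀,
      mul_div_cancel_right₀ s (by positivity)] at h0
    exact (mul_eq_zero.1 h0).resolve_left (exp_ne_zero _)
  have hae := ae_eq_zero_of_frequently_integral_exp_mul_eq_zero hγ hf_cont.measurable hf_bdd
    (hmoment.filter_mono nhdsWithin_le_nhds).frequently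
  have hvol : f =ᵐ[volume] 0 :=
    (ProbabilityTheory.gaussianReal_absolutelyContinuous' 0 hv).ae_le hae
  exact congrFun ((hf_cont.ae_eq_iff_eq volume continuous_zero).1 hvol)
end
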